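/- arXiv:2306.02158 — 4 statements merged into one kernel-verified Lean document; each statement's English description precedes it below -/
import Mathlib

section
/- Let θ' ∈ (0,∞)^V and T ∈ (0,∞)^V be such that H^{(T)} := diag(1/T) − W is positive definite, and set K_T = Id − diag(T)·W, W̃ = W + W·(H^{(T)})^{−1}·W and η̃ = W̃·(diag(T)·η) + η. Then ∫_{ℝ^V} 1_{2T_iβ_i < 1 for all i} · exp(Σ_{i∈V} (θ_i² β_i − β_i θ'_i²/(1 − 2T_iβ_i))) · ∏_{i∈V} (1 − 2T_iβ_i)^{−3/2} dν_V^{W,θ,η}(β) = exp(−(1/2)⟨θ', W̃ θ'⟩ − (1/2)⟨η, (H^{(T)})^{−1} η⟩ − ⟨η̃, θ'⟩ + (1/2)⟨θ, W θ⟩ + ⟨η, θ⟩) · (∏_{i∈V} θ_i/θ'_i) / √(det K_T). -/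
open MeasureTheory Matrix

variable {V : Type*}

/-- `H_β = 2 diag(β) − W`. -/
noncomputable def Hmat [Fintype V] [DecidableEq V] (W : Matrix V V ℝ) (β : V → ℝ) :
    Matrix V V ℝ :=
  Matrix.diagonal (fun i => 2 * β i) - W

/-- Density of the measure `ν_V^{W,θ,η}` with respect to Lebesgue measure on `ℝ^V`. -/
noncomputable def nuDensity [Fintype V] [DecidableEq V] (W : Matrix V V ℝ) (θ η : V → ℝ)
    (β : V → ℝ) : ℝ :=
  Set.indicator {β : V → ℝ | (Hmat W β).PosDef}
    (fun β =>
      (2 / Real.pi) ^ ((Fintype.card V : ℝ) / 2) *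
        Real.exp (-(1 / 2) * (θ ⬝ᵥ Hmat W β *ᵥ θ)
          - (1 / 2) * (η ⬝ᵥ (Hmat W β)⁻¹ *ᵥ η) + η ⬝ᵥ θ) *
        (∏ i, θ i) / Real.sqrt (Hmat W β).det) β

/-- The measure `ν_V^{W,θ,η}` on `ℝ^V`. -/
noncomputable def nu [Fintype V] [DecidableEq V] (W : Matrix V V ℝ) (θ η : V → ℝ) :
    Measure (V → ℝ) :=
  volume.withDensity (fun β => ENNReal.ofReal (nuDensity W θ η β))


lemma aux_gauss : ∫⁻ u : ℝ, ENNReal.ofReal (Real.exp (-u^2/2)) = ENNReal.ofReal (Real.sqrt (2*Real.pi)) := by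
  have h := integral_gaussian (1/2)
  have hi := integrable_exp_neg_mul_sq (b := 1/2) (by norm_num)
  rw [show (fun u : ℝ => ENNReal.ofReal (Real.exp (-u^2/2))) = fun u => ENNReal.ofReal (Real.exp (-(1/2)*u^2)) by
    ext u; ring_nf]
  rw [← ofReal_integral_eq_lintegral_ofReal hi (Filter.Eventually.of_forall fun x => (Real.exp_pos _).le), h]
  congr 2; ring

lemma aux_J (a c : ℝ) (ha : 0 < a) (hc : 0 ≤ c) :
    ∫⁻ t in Set.Ioi (0:ℝ), ENNReal.ofReal (Real.exp (-(a*t-c/t)^2/2)) =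
      ENNReal.ofReal (Real.sqrt (2*Real.pi) / (2*a)) := by
  rcases hc.eq_or_lt with rfl | hc
  · have h := integral_gaussian_Ioi (a^2/2)
    have hi := (integrable_exp_neg_mul_sq (b := a^2/2) (by positivity)).integrableOn (s := Set.Ioi 0)
    rw [show (fun u : ℝ => ENNReal.ofReal (Real.exp (-(a*u-0/u)^2/2))) = fun u => ENNReal.ofReal (Real.exp (-(a^2/2)*u^2)) by
      ext u; ring_nf]
    rw [← ofReal_integral_eq_lintegral_ofReal hi (Filter.Eventually.of_forall fun x => (Real.exp_pos _).le), h]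
    congr 1
    rw [show Real.pi/(a^2/2) = (2*Real.pi)/a^2 by field_simp, Real.sqrt_div (by positivity),
      Real.sqrt_sq ha.le]
    field_simp
  set E : ℝ → ℝ := fun t => Real.exp (-(a*t-c/t)^2/2) with hE
  have hEm : Measurable E := by rw [hE]; fun_prop
  set J := ∫⁻ t in Set.Ioi (0:ℝ), ENNReal.ofReal (E t) with hJ
  have h1 : ENNReal.ofReal (Real.sqrt (2*Real.pi)) = ∫⁻ t in Set.Ioi (0:ℝ), ENNReal.ofReal ((a + c/t^2) * E t) := by
    have himg : (fun t : ℝ => a*t - c/t) '' Set.Ioi 0 = Set.univ := by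
      rw [Set.eq_univ_iff_forall]
      intro u
      refine ⟨(u + Real.sqrt (u^2+4*a*c))/(2*a), ?_, ?_⟩
      · have : |u| < Real.sqrt (u^2+4*a*c) := by
          rw [← Real.sqrt_sq_eq_abs]
          exact Real.sqrt_lt_sqrt (sq_nonneg _) (by nlinarith [mul_pos ha hc])
        have := neg_abs_le u
        simp only [Set.mem_Ioi]
        apply div_pos <;> linarith
      · have h0 : |u| < Real.sqrt (u^2+4*a*c) := by
          rw [← Real.sqrt_sq_eq_abs]
          exact Real.sqrt_lt_sqrt (sq_nonneg _) (by nlinarith [mul_pos ha hc])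
        have h1 := neg_abs_le u
        have h2 : 0 < u + Real.sqrt (u^2+4*a*c) := by linarith
        have h3 : Real.sqrt (u^2+4*a*c)^2 = u^2+4*a*c := Real.sq_sqrt (by nlinarith [mul_pos ha hc, sq_nonneg u])
        simp only
        generalize Real.sqrt (u^2+4*a*c) = q at *
        field_simp
        nlinarith
    have := lintegral_image_eq_lintegral_abs_deriv_mul (s := Set.Ioi 0) (f := fun t : ℝ => a*t - c/t)
      (f' := fun t => a + c/t^2) measurableSet_Ioi
      (fun x hx => by
        have hx' : x ≠ 0 := ne_of_gt hx
        have := ((hasDerivAt_id x).const_mul a).sub ((hasDerivAt_inv hx').const_mul c)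
        refine (this.congr_deriv ?_).hasDerivWithinAt
        field_simp; ring)
      (by
        intro x hx y hy hxy
        have hx' : 0 < x := hx
        have hy' : 0 < y := hy
        simp only at hxy
        have h : (x - y) * (a + c/(x*y)) = 0 := by
          have : a*x - c/x - (a*y - c/y) = (x - y) * (a + c/(x*y)) := by field_simp; ring
          rw [← this, hxy]; ring
        rcases mul_eq_zero.1 h with h | h
        · linarith
        · have : 0 < a + c/(x*y) := by positivity
          linarith)
      (fun u => ENNReal.ofReal (Real.exp (-u^2/2)))
    rw [himg, setLIntegral_univ, aux_gauss] at this
    rw [this]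
    refine setLIntegral_congr_fun measurableSet_Ioi fun t ht => ?_
    have ht' : 0 < t := ht
    have hp : 0 < a + c/t^2 := by positivity
    rw [abs_of_pos hp, ENNReal.ofReal_mul hp.le]
  have h2 : J = ∫⁻ t in Set.Ioi (0:ℝ), ENNReal.ofReal (c/(a*t^2) * E t) := by
    have himg : (fun t : ℝ => c/a/t) '' Set.Ioi 0 = Set.Ioi 0 := by
      ext u; constructor
      · rintro ⟨t, ht, rfl⟩
        have ht' : 0 < t := ht
        show 0 < c/a/t
        positivity
      · intro hu
        have hu' : 0 < u := hu
        refine ⟨c/a/u, ?_, ?_⟩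
        · show 0 < c/a/u
          positivity
        · simp only; field_simp
    have := lintegral_image_eq_lintegral_abs_deriv_mul (s := Set.Ioi 0) (f := fun t : ℝ => c/a/t)
      (f' := fun t => -(c/(a*t^2))) measurableSet_Ioi
      (fun x hx => by
        have hx' : x ≠ 0 := ne_of_gt hx
        have := ((hasDerivAt_inv hx').const_mul (c/a))
        refine (this.congr_deriv ?_).hasDerivWithinAt
        field_simp)
      (by
        intro x hx y hy hxy
        have hx' : 0 < x := hx
        have hy' : 0 < y := hy
        simp only at hxy
        field_simp at hxy
        exact hxy.symm)
      (fun u => ENNReal.ofReal (E u))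
    rw [himg] at this
    rw [hJ, this]
    refine setLIntegral_congr_fun measurableSet_Ioi fun t ht => ?_
    have ht' : 0 < t := ht
    have hp : 0 < c/(a*t^2) := by positivity
    rw [abs_neg, abs_of_pos hp, ENNReal.ofReal_mul hp.le]
    congr 2
    simp only [hE]
    congr 2
    field_simp
    ring
  have h3 : ENNReal.ofReal (Real.sqrt (2*Real.pi)) = ENNReal.ofReal (2*a) * J := by
    rw [h1]
    have : ∀ t ∈ Set.Ioi (0:ℝ), ENNReal.ofReal ((a + c/t^2) * E t) =
        ENNReal.ofReal a * ENNReal.ofReal (E t) + ENNReal.ofReal a * ENNReal.ofReal (c/(a*t^2) * E t) := by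
      intro t ht
      have ht' : 0 < t := ht
      have hEp : 0 < E t := Real.exp_pos _
      rw [← ENNReal.ofReal_mul ha.le, ← ENNReal.ofReal_mul ha.le, ← ENNReal.ofReal_add (by positivity) (by positivity)]
      congr 1
      field_simp
    rw [setLIntegral_congr_fun measurableSet_Ioi this, lintegral_add_left (by fun_prop),
      lintegral_const_mul _ (by fun_prop), lintegral_const_mul _ (by fun_prop), ← h2, ← hJ, ← two_mul,
      ENNReal.ofReal_mul (by norm_num)]
    simp [mul_assoc]
  rw [ENNReal.ofReal_div_of_pos (by positivity), h3, mul_comm]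
  rw [ENNReal.mul_div_cancel_right]
  · simpa using ha
  · exact ENNReal.ofReal_ne_top

lemma aux_oneD (a c : ℝ) (ha : 0 < a) (hc : 0 ≤ c) :
    ∫⁻ s in Set.Ioi (0:ℝ), ENNReal.ofReal (Real.exp (-(1/2)*(a^2*s) - (1/2)*(c^2/s)) / Real.sqrt s) =
      ENNReal.ofReal (Real.sqrt (2*Real.pi) / a * Real.exp (-(a*c))) := by
  have himg : (fun t : ℝ => t^2) '' Set.Ioi 0 = Set.Ioi 0 := by
    ext u; constructor
    · rintro ⟨t, ht, rfl⟩
      have ht' : 0 < t := ht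
      show 0 < t^2
      positivity
    · intro hu
      have hu' : 0 < u := hu
      exact ⟨Real.sqrt u, Real.sqrt_pos.2 hu', Real.sq_sqrt hu'.le⟩
  have := lintegral_image_eq_lintegral_abs_deriv_mul (s := Set.Ioi 0) (f := fun t : ℝ => t^2)
      (f' := fun t => 2*t) measurableSet_Ioi
      (fun x hx => by simpa using (hasDerivAt_pow 2 x).hasDerivWithinAt)
      (by
        intro x hx y hy hxy
        have hx' : 0 < x := hx
        have hy' : 0 < y := hy
        simp only at hxy
        exact (pow_left_inj₀ hx'.le hy'.le two_ne_zero).1 hxy)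
      (fun s => ENNReal.ofReal (Real.exp (-(1/2)*(a^2*s) - (1/2)*(c^2/s)) / Real.sqrt s))
  rw [himg] at this
  rw [this]
  have h : ∀ t ∈ Set.Ioi (0:ℝ), ENNReal.ofReal |2*t| * ENNReal.ofReal (Real.exp (-(1/2)*(a^2*t^2) - (1/2)*(c^2/t^2)) / Real.sqrt (t^2))
     = ENNReal.ofReal (2 * Real.exp (-(a*c))) * ENNReal.ofReal (Real.exp (-(a*t-c/t)^2/2)) := by
    intro t ht
    have ht' : 0 < t := ht
    rw [abs_of_pos (by positivity), ← ENNReal.ofReal_mul (by positivity), ← ENNReal.ofReal_mul (by positivity),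
      Real.sqrt_sq ht'.le, mul_assoc, mul_assoc, ← Real.exp_add]
    congr 1
    rw [mul_div_cancel₀ _ ht'.ne']
    congr 2
    field_simp
    ring
  rw [setLIntegral_congr_fun measurableSet_Ioi h, lintegral_const_mul _ (by fun_prop), aux_J a c ha hc,
    ← ENNReal.ofReal_mul (by positivity)]
  congr 1
  field_simp

lemma aux_oneD' (a c k : ℝ) (ha : 0 < a) (hc : 0 ≤ c) :
    ∫⁻ x in {x : ℝ | 0 < 2*x-k}, ENNReal.ofReal (Real.exp (-(1/2)*(a^2*(2*x-k)) - (1/2)*(c^2/(2*x-k))) / Real.sqrt (2*x-k)) =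
      ENNReal.ofReal (Real.sqrt (Real.pi/2) / a * Real.exp (-(a*c))) := by
  have hm : MeasurableSet {x : ℝ | 0 < 2*x-k} := measurableSet_lt (by fun_prop) (by fun_prop)
  have himg : (fun x : ℝ => 2*x-k) '' {x : ℝ | 0 < 2*x-k} = Set.Ioi 0 := by
    ext u; constructor
    · rintro ⟨t, ht, rfl⟩
      exact ht
    · intro hu
      have hu' : 0 < u := hu
      refine ⟨(u+k)/2, ?_, ?_⟩
      · show 0 < 2*((u+k)/2)-k
        linarith
      · simp only; ring
  have := lintegral_image_eq_lintegral_abs_deriv_mul (s := {x : ℝ | 0 < 2*x-k}) (f := fun x : ℝ => 2*x-k)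
      (f' := fun t => 2) hm
      (fun x hx => by simpa using (((hasDerivAt_id x).const_mul 2).sub_const k).hasDerivWithinAt)
      (by
        intro x hx y hy hxy
        simp only at hxy
        linarith)
      (fun s => ENNReal.ofReal (Real.exp (-(1/2)*(a^2*s) - (1/2)*(c^2/s)) / Real.sqrt s))
  rw [himg, aux_oneD a c ha hc, lintegral_const_mul _ (by fun_prop)] at this
  have h2 : Real.sqrt (Real.pi/2) = Real.sqrt (2*Real.pi)/2 := by
    rw [show Real.pi/2 = (2*Real.pi)/2^2 by ring, Real.sqrt_div (by positivity), Real.sqrt_sq (by norm_num)]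
  rw [h2, show Real.sqrt (2*Real.pi)/2 / a * Real.exp (-(a*c)) = (Real.sqrt (2*Real.pi) / a * Real.exp (-(a*c)))/2 by ring,
    ENNReal.ofReal_div_of_pos (by norm_num), this, mul_comm, abs_of_pos (by norm_num), ENNReal.mul_div_cancel_right]
  · simp
  · exact ENNReal.ofReal_ne_top

lemma aux_blk_det [Fintype V] [DecidableEq V] (A : Matrix V V ℝ) (hA : A.PosDef) (b : V → ℝ) (d : ℝ) :
    (fromBlocks A (of fun i (_ : Unit) => - b i) (of fun (_ : Unit) i => - b i) (of fun _ _ => d)).det =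
      A.det * (d - b ⬝ᵥ (A⁻¹ *ᵥ b)) := by
  have := hA.isUnit
  let := this.invertible
  rw [det_fromBlocks₁₁]
  congr 1
  rw [det_unique, Matrix.sub_apply, invOf_eq_nonsing_inv, Matrix.mul_assoc]
  simp [Matrix.mul_apply, dotProduct, mulVec, Finset.mul_sum]

lemma aux_blk_posDef [Fintype V] [DecidableEq V] (A : Matrix V V ℝ) (b : V → ℝ) (d : ℝ) :
    (fromBlocks A (of fun i (_ : Unit) => - b i) (of fun (_ : Unit) i => - b i) (of fun _ _ => d)).PosDef ↔
      A.PosDef ∧ 0 < d - b ⬝ᵥ (A⁻¹ *ᵥ b) := by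
  constructor
  · intro h
    have hA : A.PosDef := h.submatrix (e := Sum.inl) Sum.inl_injective
    refine ⟨hA, ?_⟩
    have := h.det_pos
    rw [aux_blk_det A hA] at this
    exact (mul_pos_iff_of_pos_left hA.det_pos).1 this
  · rintro ⟨hA, hs⟩
    let := hA.isUnit.invertible
    have hB : (of fun (_ : Unit) i => - b i) = (of fun i (_ : Unit) => - b i)ᴴ := by
      ext i j; simp
    have hps : (fromBlocks A (of fun i (_ : Unit) => - b i) (of fun (_ : Unit) i => - b i) (of fun _ _ => d)).PosSemidef := by
      rw [hB, PosDef.fromBlocks₁₁ _ _ hA, ← hB]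
      have : (of fun (_ : Unit) (_ : Unit) => d) - (of fun (_ : Unit) i => - b i) * A⁻¹ * (of fun i (_ : Unit) => - b i)
          = diagonal fun _ => d - b ⬝ᵥ (A⁻¹ *ᵥ b) := by
        ext i j
        rw [Matrix.mul_assoc]
        simp [Matrix.mul_apply, dotProduct, mulVec, Finset.mul_sum]
      rw [this]
      exact PosSemidef.diagonal fun _ => hs.le
    rw [hps.posDef_iff_det_ne_zero, aux_blk_det A hA]
    exact (mul_pos hA.det_pos hs).ne'

lemma aux_inv_quad [Fintype V] [DecidableEq V] (A : Matrix V V ℝ) (hA : IsUnit A) (x y : V → ℝ) (h : A *ᵥ x = y) :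
    A⁻¹ *ᵥ y = x := by
  rw [← h, mulVec_mulVec, nonsing_inv_mul _ ((isUnit_iff_isUnit_det _).1 hA), one_mulVec]

lemma aux_Minv [Fintype V] [DecidableEq V] (A : Matrix V V ℝ) (hA : A.PosDef) (hoff : ∀ i j, i ≠ j → A i j ≤ 0)
    (y : V → ℝ) (hy : ∀ i, 0 ≤ y i) (i : V) : 0 ≤ (A⁻¹ *ᵥ y) i := by
  set x := A⁻¹ *ᵥ y with hx
  have hAx : A *ᵥ x = y := by
    rw [hx, mulVec_mulVec, mul_nonsing_inv _ ((isUnit_iff_isUnit_det _).1 hA.isUnit), one_mulVec]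
  set z : V → ℝ := fun i => max (-x i) 0 with hz
  have hz0 : ∀ i, 0 ≤ z i := fun i => le_max_right _ _
  by_contra hneg
  push Not at hneg
  have hzne : z ≠ 0 := by
    intro h
    have := congrFun h i
    simp only [hz, Pi.zero_apply] at this
    have := le_max_left (-x i) 0
    linarith
  have hpos := hA.dotProduct_mulVec_pos hzne
  simp only [star_trivial] at hpos
  have h1 : 0 ≤ z ⬝ᵥ (A *ᵥ x) := by
    rw [hAx]; exact Finset.sum_nonneg fun i _ => mul_nonneg (hz0 i) (hy i)
  have h2 : z ⬝ᵥ (A *ᵥ (x + z)) ≤ 0 := by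
    simp only [dotProduct, mulVec, Finset.mul_sum]
    refine Finset.sum_nonpos fun i _ => Finset.sum_nonpos fun j _ => ?_
    have hj : 0 ≤ (x+z) j := by
      simp only [Pi.add_apply, hz]
      linarith [le_max_left (-x j) 0]
    by_cases hij : i = j
    · subst hij
      have : z i * (x+z) i = 0 := by
        simp only [Pi.add_apply, hz]
        rcases le_total (-x i) 0 with h | h
        · rw [max_eq_right h]; ring
        · rw [max_eq_left h]; ring
      rw [mul_left_comm, this]; simp
    · exact mul_nonpos_of_nonneg_of_nonpos (hz0 i) (mul_nonpos_of_nonpos_of_nonneg (hoff i j hij) hj)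
  rw [mulVec_add, dotProduct_add] at h2
  linarith

lemma aux_measPD [Fintype V] [DecidableEq V] {X : Type*} [MeasurableSpace X] (A : X → Matrix V V ℝ)
    (hA : ∀ i j, Measurable fun x => A x i j) (hH : ∀ x, (A x).IsHermitian) :
    MeasurableSet {x | (A x).PosDef} := by
  let : MeasurableSpace (Matrix V V ℝ) := inferInstanceAs (MeasurableSpace (V → V → ℝ))
  have hAm : Measurable A := measurable_pi_lambda _ fun i => measurable_pi_lambda _ fun j => hA i j
  have hcl : IsClosed {M : Matrix V V ℝ | ∀ x : V → ℝ, 0 ≤ x ⬝ᵥ (M *ᵥ x)} := by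
    simp only [Set.ofPred_forall]
    refine isClosed_iInter fun x => isClosed_le continuous_const ?_
    fun_prop
  have hop : IsOpen {M : Matrix V V ℝ | M.det ≠ 0} :=
    isOpen_ne_fun (by fun_prop) continuous_const
  have heq : {x | (A x).PosDef} = A ⁻¹' {M : Matrix V V ℝ | ∀ x : V → ℝ, 0 ≤ x ⬝ᵥ (M *ᵥ x)} ∩
      A ⁻¹' {M : Matrix V V ℝ | M.det ≠ 0} := by
    ext x
    simp only [Set.mem_inter_iff, Set.mem_preimage, Set.mem_ofPred_eq]
    constructor
    · intro h
      exact ⟨fun y => by simpa using h.posSemidef.dotProduct_mulVec_nonneg y, h.det_pos.ne'⟩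
    · rintro ⟨h1, h2⟩
      exact (PosSemidef.of_dotProduct_mulVec_nonneg (hH x) (by simpa using h1)).posDef_iff_det_ne_zero.2 h2
  rw [heq]
  have : BorelSpace (Matrix V V ℝ) := inferInstanceAs (BorelSpace (V → V → ℝ))
  exact (hAm hcl.measurableSet).inter (hAm hop.measurableSet)

lemma aux_measDet [Fintype V] [DecidableEq V] {X : Type*} [MeasurableSpace X] (A : X → Matrix V V ℝ)
    (hA : ∀ i j, Measurable fun x => A x i j) : Measurable fun x => (A x).det := by
  let : MeasurableSpace (Matrix V V ℝ) := inferInstanceAs (MeasurableSpace (V → V → ℝ))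
  have hAm : Measurable A := measurable_pi_lambda _ fun i => measurable_pi_lambda _ fun j => hA i j
  have : BorelSpace (Matrix V V ℝ) := inferInstanceAs (BorelSpace (V → V → ℝ))
  exact (show Continuous fun M : Matrix V V ℝ => M.det by fun_prop).measurable.comp hAm

lemma aux_measQ [Fintype V] [DecidableEq V] {X : Type*} [MeasurableSpace X] (A : X → Matrix V V ℝ)
    (hA : ∀ i j, Measurable fun x => A x i j) (θ : V → ℝ) : Measurable fun x => θ ⬝ᵥ (A x *ᵥ θ) := by
  simp only [dotProduct, mulVec]
  fun_prop

lemma aux_measInv [Fintype V] [DecidableEq V] {X : Type*} [MeasurableSpace X] (A : X → Matrix V V ℝ)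
    (hA : ∀ i j, Measurable fun x => A x i j) (i j) : Measurable fun x => (A x)⁻¹ i j := by
  let : MeasurableSpace (Matrix V V ℝ) := inferInstanceAs (MeasurableSpace (V → V → ℝ))
  have hAm : Measurable A := measurable_pi_lambda _ fun i => measurable_pi_lambda _ fun j => hA i j
  have : BorelSpace (Matrix V V ℝ) := inferInstanceAs (BorelSpace (V → V → ℝ))
  have h2 : Measurable fun x => (A x).adjugate i j :=
    (show Continuous fun M : Matrix V V ℝ => M.adjugate i j from
      (Continuous.matrix_adjugate continuous_id).matrix_elem i j).measurable.comp hAm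
  simp only [inv_def, Matrix.smul_apply, smul_eq_mul, Ring.inverse_eq_inv']
  exact (aux_measDet A hA).inv.mul h2

lemma aux_symm [Fintype V] (A : Matrix V V ℝ) (hA : A.IsSymm) (u v : V → ℝ) :
    u ⬝ᵥ (A *ᵥ v) = v ⬝ᵥ (A *ᵥ u) := by
  rw [dotProduct_mulVec, ← mulVec_transpose, hA.eq, dotProduct_comm]

lemma aux_quad1 [Fintype V] [DecidableEq V] (A : Matrix V V ℝ) (b : V → ℝ) (d : ℝ)
    (θ : V ⊕ Unit → ℝ) :
    θ ⬝ᵥ (fromBlocks A (of fun i (_ : Unit) => - b i) (of fun (_ : Unit) i => - b i) (of fun _ _ => d)) *ᵥ θ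
      = (θ ∘ Sum.inl) ⬝ᵥ A *ᵥ (θ ∘ Sum.inl) - 2 * θ (Sum.inr ()) * (b ⬝ᵥ (θ ∘ Sum.inl)) + θ (Sum.inr ())^2 * d := by
  have : ∀ i, ∑ j, A i j * θ (Sum.inl j) = (A *ᵥ (θ ∘ Sum.inl)) i := fun i => rfl
  simp only [fromBlocks_mulVec]
  simp only [dotProduct, Fintype.sum_sum_type, Sum.elim_inl, Sum.elim_inr, Pi.add_apply, mulVec,
    Finset.univ_unique, Finset.sum_singleton, of_apply, Function.comp, mul_add, Finset.sum_add_distrib]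
  rw [Finset.mul_sum, Finset.mul_sum]
  have e1 : ∑ x, θ (Sum.inl x) * (-b x * θ (Sum.inr default)) = - ∑ x, θ (Sum.inr ()) * (b x * θ (Sum.inl x)) := by
    rw [← Finset.sum_neg_distrib]; refine Finset.sum_congr rfl fun x _ => ?_
    show _ * (_ * θ (Sum.inr ())) = _
    ring
  have e2 : ∑ x, θ (Sum.inr default) * (-b x * θ (Sum.inl x)) = - ∑ x, θ (Sum.inr ()) * (b x * θ (Sum.inl x)) := by
    rw [← Finset.sum_neg_distrib]; refine Finset.sum_congr rfl fun x _ => ?_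
    show θ (Sum.inr ()) * _ = _
    ring
  have e3 : ∑ x, 2 * θ (Sum.inr ()) * (b x * θ (Sum.inl x)) = 2 * ∑ x, θ (Sum.inr ()) * (b x * θ (Sum.inl x)) := by
    rw [Finset.mul_sum]; refine Finset.sum_congr rfl fun x _ => ?_
    ring
  rw [e1, e2, e3]
  show _ + (_ + θ (Sum.inr ()) * (d * θ (Sum.inr ()))) = _
  ring

lemma aux_quad2 [Fintype V] [DecidableEq V] (A : Matrix V V ℝ) (hA : A.PosDef) (b : V → ℝ) (d : ℝ)
    (hs : 0 < d - b ⬝ᵥ (A⁻¹ *ᵥ b)) (η : V ⊕ Unit → ℝ) :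
    η ⬝ᵥ (fromBlocks A (of fun i (_ : Unit) => - b i) (of fun (_ : Unit) i => - b i) (of fun _ _ => d))⁻¹ *ᵥ η
      = (η ∘ Sum.inl) ⬝ᵥ A⁻¹ *ᵥ (η ∘ Sum.inl) +
        (η (Sum.inr ()) + b ⬝ᵥ A⁻¹ *ᵥ (η ∘ Sum.inl))^2 / (d - b ⬝ᵥ (A⁻¹ *ᵥ b)) := by
  have hAs : A⁻¹.IsSymm := by
    have := hA.inv.isHermitian
    simpa [IsHermitian, IsSymm, conjTranspose_eq_transpose_of_trivial] using this
  have hM := (aux_blk_posDef A b d).2 ⟨hA, hs⟩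
  set s := d - b ⬝ᵥ (A⁻¹ *ᵥ b) with hsdef
  set c := η (Sum.inr ()) + b ⬝ᵥ A⁻¹ *ᵥ (η ∘ Sum.inl) with hc
  have hAA : ∀ v, A *ᵥ (A⁻¹ *ᵥ v) = v := fun v => by
    rw [mulVec_mulVec, mul_nonsing_inv _ ((isUnit_iff_isUnit_det _).1 hA.isUnit), one_mulVec]
  have hx := aux_inv_quad _ hM.isUnit (Sum.elim (A⁻¹ *ᵥ (η ∘ Sum.inl) + (c/s) • (A⁻¹ *ᵥ b)) (fun _ => c/s)) η (by
    rw [fromBlocks_mulVec]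
    ext i
    rcases i with i | i
    · simp only [Sum.elim_comp_inl, Sum.elim_comp_inr, Sum.elim_inl, mulVec_add, mulVec_smul, hAA]
      simp [mulVec, dotProduct]
      ring
    · simp only [Sum.elim_comp_inl, Sum.elim_comp_inr, Sum.elim_inr, Pi.add_apply]
      have : ∀ v, ((of fun (_ : Unit) i => - b i) *ᵥ v) i = - (b ⬝ᵥ v) := fun v => by
        simp [mulVec, dotProduct]
      rw [this, dotProduct_add, dotProduct_smul]
      simp only [mulVec, dotProduct, Finset.univ_unique, Finset.sum_singleton, of_apply, smul_eq_mul]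
      change -(b ⬝ᵥ A⁻¹ *ᵥ (η ∘ Sum.inl) + c/s * (b ⬝ᵥ A⁻¹ *ᵥ b)) + d * (c/s) = η (Sum.inr ())
      have : d = s + (b ⬝ᵥ A⁻¹ *ᵥ b) := by rw [hsdef]; ring
      rw [this]
      have : (s + b ⬝ᵥ A⁻¹ *ᵥ b) * (c/s) = c + c/s * (b ⬝ᵥ A⁻¹ *ᵥ b) := by field_simp
      rw [this, hc]; ring)
  rw [hx]
  have : ∀ (u : V → ℝ) (r : ℝ), η ⬝ᵥ (Sum.elim u (fun _ => r)) = (η ∘ Sum.inl) ⬝ᵥ u + η (Sum.inr ()) * r := by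
    intro u r
    simp [dotProduct]
  rw [this, dotProduct_add, dotProduct_smul, aux_symm _ hAs (η ∘ Sum.inl) b, smul_eq_mul]
  have : η (Sum.inr ()) = c - b ⬝ᵥ A⁻¹ *ᵥ (η ∘ Sum.inl) := by rw [hc]; ring
  rw [this]; ring

noncomputable def auxF [Fintype V] [DecidableEq V] (W : Matrix V V ℝ) (θ η : V → ℝ) (β : V → ℝ) : ENNReal :=
  Set.indicator {β : V → ℝ | (Hmat W β).PosDef}
    (fun β => ENNReal.ofReal (Real.exp (-(1 / 2) * (θ ⬝ᵥ Hmat W β *ᵥ θ)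
          - (1 / 2) * (η ⬝ᵥ (Hmat W β)⁻¹ *ᵥ η)) / Real.sqrt (Hmat W β).det)) β

lemma aux_Hherm [Fintype V] [DecidableEq V] (W : Matrix V V ℝ) (hW : W.IsSymm) (β : V → ℝ) :
    (Hmat W β).IsHermitian := by
  unfold Hmat
  rw [IsHermitian, conjTranspose_eq_transpose_of_trivial, transpose_sub, hW.eq, diagonal_transpose]

lemma aux_Hmeas [Fintype V] [DecidableEq V] (W : Matrix V V ℝ) (i j : V) :
    Measurable fun β => Hmat W β i j := by
  unfold Hmat
  by_cases h : i = j
  · subst h; simp only [Matrix.sub_apply, diagonal_apply_eq]; fun_prop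
  · simp only [Matrix.sub_apply, diagonal_apply_ne _ h]; fun_prop

lemma aux_Fset [Fintype V] [DecidableEq V] (W : Matrix V V ℝ) (hW : W.IsSymm) :
    MeasurableSet {β : V → ℝ | (Hmat W β).PosDef} :=
  aux_measPD _ (aux_Hmeas W) (aux_Hherm W hW)

lemma aux_Fmeas [Fintype V] [DecidableEq V] (W : Matrix V V ℝ) (hW : W.IsSymm) (θ η : V → ℝ) :
    Measurable (auxF W θ η) := by
  unfold auxF
  refine Measurable.indicator ?_ (aux_Fset W hW)
  have h1 := aux_measQ _ (aux_Hmeas W) θ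
  have h2 := aux_measQ _ (aux_measInv _ (aux_Hmeas W)) η
  have h3 := aux_measDet _ (aux_Hmeas W)
  fun_prop

def auxP (V : Type*) : Prop := ∀ [Fintype V] [DecidableEq V] (W : Matrix V V ℝ) (_ : W.IsSymm) (_ : ∀ i j, 0 ≤ W i j)
    (θ η : V → ℝ) (_ : ∀ i, 0 < θ i) (_ : ∀ i, 0 ≤ η i),
    ∫⁻ β, auxF W θ η β = ENNReal.ofReal (Real.sqrt (Real.pi/2) ^ (Fintype.card V) * Real.exp (-(η ⬝ᵥ θ)) / ∏ i, θ i)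

lemma aux_empty (V : Type*) [IsEmpty V] : auxP V := by
  intro _ _ W _ _ θ η _ _
  have : ∀ β, auxF W θ η β = 1 := by
    intro β
    unfold auxF
    rw [Set.indicator_of_mem]
    · simp [dotProduct]
    · refine ⟨aux_Hherm W (by ext i; exact isEmptyElim i) β, fun x hx => (hx (by ext i; exact isEmptyElim i)).elim⟩
  simp [this, dotProduct, volume_pi]

lemma aux_equiv {α β : Type*} (e : α ≃ β) (h : auxP α) : auxP β := by
  intro _ _ W hW hW0 θ η hθ hη
  let := Fintype.ofEquiv β e.symm
  let := e.decidableEq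
  have h' := h (W.submatrix e e) (hW.submatrix e) (fun i j => hW0 _ _) (θ ∘ e) (η ∘ e) (fun i => hθ _) (fun i => hη _)
  have hmp := volume_measurePreserving_piCongrLeft (fun _ : β => ℝ) e
  rw [← hmp.lintegral_comp_emb (MeasurableEquiv.measurableEmbedding _)]
  rw [Fintype.card_congr e] at h'
  have e1 : (η ∘ e) ⬝ᵥ (θ ∘ e) = η ⬝ᵥ θ := by
    simp [dotProduct, e.sum_comp (fun i => η i * θ i)]
  have e2 : ∏ i, (θ ∘ e) i = ∏ i, θ i := e.prod_comp θ
  rw [e1, e2] at h'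
  rw [← h']
  congr 1
  ext b
  have hb : ∀ i, (MeasurableEquiv.piCongrLeft (fun _ : β => ℝ) e) b (e i) = b i := fun i =>
    Equiv.piCongrLeft_apply_apply (fun _ : β => ℝ) e b i
  set b' := (MeasurableEquiv.piCongrLeft (fun _ : β => ℝ) e) b
  have hH : Hmat (W.submatrix e e) b = (Hmat W b').submatrix e e := by
    ext i j
    simp only [Hmat, Matrix.sub_apply, submatrix_apply, diagonal_apply, hb, e.injective.eq_iff]
  have hq : ∀ (M : Matrix β β ℝ) (v : β → ℝ), (v ∘ e) ⬝ᵥ (M.submatrix e e) *ᵥ (v ∘ e) = v ⬝ᵥ M *ᵥ v := by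
    intro M v
    rw [submatrix_mulVec_equiv]
    simp [dotProduct, e.sum_comp (fun i => v i * (M *ᵥ v) i), Function.comp_assoc]
  unfold auxF
  have hpd : ((Hmat W b').submatrix e e).PosDef ↔ (Hmat W b').PosDef := by
    constructor
    · intro h
      have := h.submatrix (e := e.symm) e.symm.injective
      simpa using this
    · intro h
      exact h.submatrix e.injective
  by_cases hp : (Hmat W b').PosDef
  · rw [Set.indicator_of_mem (by exact hp), Set.indicator_of_mem (by show (Hmat _ _).PosDef; rw [hH]; exact hpd.2 hp)]
    rw [hH, inv_submatrix_equiv, hq, hq, det_submatrix_equiv_self]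
  · rw [Set.indicator_of_notMem (by exact hp), Set.indicator_of_notMem (by show ¬ (Hmat _ _).PosDef; rw [hH]; exact fun h => hp (hpd.1 h))]

lemma aux_inner [Fintype V] [DecidableEq V] (W : Matrix (V ⊕ Unit) (V ⊕ Unit) ℝ) (hW : W.IsSymm) (hW0 : ∀ i j, 0 ≤ W i j)
    (θ η : V ⊕ Unit → ℝ) (hθ : ∀ i, 0 < θ i) (hη : ∀ i, 0 ≤ η i) (x : V → ℝ) :
    ∫⁻ t : ℝ, auxF W θ η (Sum.elim x (fun _ => t)) =
      ENNReal.ofReal (Real.sqrt (Real.pi/2) / θ (Sum.inr ()) *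
        Real.exp (θ (Sum.inr ()) * ((fun i => W (Sum.inl i) (Sum.inr ())) ⬝ᵥ (θ ∘ Sum.inl)) - θ (Sum.inr ()) * η (Sum.inr ()))) *
      auxF W.toBlocks₁₁ (θ ∘ Sum.inl) ((η ∘ Sum.inl) + θ (Sum.inr ()) • (fun i => W (Sum.inl i) (Sum.inr ()))) x := by
  set w : V → ℝ := fun i => W (Sum.inl i) (Sum.inr ()) with hw
  have hH : ∀ t, Hmat W (Sum.elim x (fun _ => t)) = fromBlocks (Hmat W.toBlocks₁₁ x)
      (of fun i (_ : Unit) => - w i) (of fun (_ : Unit) i => - w i) (of fun _ _ => 2*t - W (Sum.inr ()) (Sum.inr ())) := by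
    intro t
    ext i j
    rcases i with i | i <;> rcases j with j | j
    · simp [Hmat, diagonal_apply, toBlocks₁₁]
    · simp [Hmat, hw]
    · simp [Hmat, hw]
      exact hW.apply _ _
    · simp [Hmat]
  set A := Hmat W.toBlocks₁₁ x with hAdef
  set η' := (η ∘ Sum.inl) + θ (Sum.inr ()) • w with hη'
  by_cases hA : A.PosDef
  swap
  · have h0 : auxF W.toBlocks₁₁ (θ ∘ Sum.inl) η' x = 0 := Set.indicator_of_notMem (by exact hA) _
    rw [h0, mul_zero]
    have : ∀ t, auxF W θ η (Sum.elim x (fun _ => t)) = 0 := fun t => by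
      refine Set.indicator_of_notMem ?_ _
      show ¬ (Hmat _ _).PosDef
      rw [hH, aux_blk_posDef]
      exact fun h => hA h.1
    simp [this]
  set k := W (Sum.inr ()) (Sum.inr ()) + w ⬝ᵥ A⁻¹ *ᵥ w with hk
  set c := η (Sum.inr ()) + w ⬝ᵥ A⁻¹ *ᵥ (η ∘ Sum.inl) with hc
  have hc0 : 0 ≤ c := by
    refine add_nonneg (hη _) (Finset.sum_nonneg fun i _ => mul_nonneg (hW0 _ _) ?_)
    refine aux_Minv A hA (fun i j hij => ?_) _ (fun i => hη _) i
    simp [hAdef, Hmat, diagonal_apply_ne _ hij, toBlocks₁₁, hW0]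
  have hAs : A⁻¹.IsSymm := by
    have := hA.inv.isHermitian
    simpa [IsHermitian, IsSymm, conjTranspose_eq_transpose_of_trivial] using this
  set D := Real.exp (-(1/2) * ((θ ∘ Sum.inl) ⬝ᵥ A *ᵥ (θ ∘ Sum.inl)) + θ (Sum.inr ()) * (w ⬝ᵥ (θ ∘ Sum.inl))
    - (1/2) * (θ (Sum.inr ())^2 * (w ⬝ᵥ A⁻¹ *ᵥ w)) - (1/2) * ((η ∘ Sum.inl) ⬝ᵥ A⁻¹ *ᵥ (η ∘ Sum.inl))) / Real.sqrt A.det with hD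
  have hD0 : 0 ≤ D := by positivity
  have hF : ∀ t, auxF W θ η (Sum.elim x (fun _ => t)) = Set.indicator {t : ℝ | 0 < 2*t-k} (fun t =>
      ENNReal.ofReal D * ENNReal.ofReal (Real.exp (-(1/2)*(θ (Sum.inr ())^2*(2*t-k)) - (1/2)*(c^2/(2*t-k))) / Real.sqrt (2*t-k))) t := by
    intro t
    have hs : 2*t - W (Sum.inr ()) (Sum.inr ()) - w ⬝ᵥ A⁻¹ *ᵥ w = 2*t-k := by rw [hk]; ring
    by_cases ht : 0 < 2*t-k
    · rw [Set.indicator_of_mem (by exact ht)]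
      unfold auxF
      rw [Set.indicator_of_mem]
      · rw [hH, aux_quad1, aux_quad2 A hA w _ (by rw [hs]; exact ht), aux_blk_det A hA, hs,
          Real.sqrt_mul hA.det_pos.le, ← ENNReal.ofReal_mul hD0, hD, div_mul_div_comm, ← Real.exp_add]
        congr 3
        rw [← hc]
        have : 2*t - W (Sum.inr ()) (Sum.inr ()) = (2*t-k) + w ⬝ᵥ A⁻¹ *ᵥ w := by rw [hk]; ring
        rw [this]
        ring
      · show (Hmat _ _).PosDef
        rw [hH, aux_blk_posDef, hs]
        exact ⟨hA, ht⟩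
    · rw [Set.indicator_of_notMem (by exact ht)]
      refine Set.indicator_of_notMem ?_ _
      show ¬ (Hmat _ _).PosDef
      rw [hH, aux_blk_posDef, hs]
      exact fun h => ht h.2
  have hm : MeasurableSet {x : ℝ | 0 < 2*x-k} := measurableSet_lt (by fun_prop) (by fun_prop)
  simp_rw [hF]
  rw [lintegral_indicator hm, lintegral_const_mul _ (by fun_prop), aux_oneD' _ _ _ (hθ _) hc0]
  have h0 : auxF W.toBlocks₁₁ (θ ∘ Sum.inl) η' x = _ := Set.indicator_of_mem (by exact hA) _
  have hpos : 0 < θ (Sum.inr ()) := hθ _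
  rw [h0, ← ENNReal.ofReal_mul hD0, ← ENNReal.ofReal_mul (by positivity), ← hAdef]
  congr 1
  have hq : η' ⬝ᵥ A⁻¹ *ᵥ η' = (η ∘ Sum.inl) ⬝ᵥ A⁻¹ *ᵥ (η ∘ Sum.inl) + 2 * θ (Sum.inr ()) * (w ⬝ᵥ A⁻¹ *ᵥ (η ∘ Sum.inl))
      + θ (Sum.inr ())^2 * (w ⬝ᵥ A⁻¹ *ᵥ w) := by
    rw [hη', mulVec_add, mulVec_smul, dotProduct_add, add_dotProduct, add_dotProduct, dotProduct_smul, smul_dotProduct,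
      smul_dotProduct, dotProduct_smul, aux_symm _ hAs (η ∘ Sum.inl) w]
    simp only [smul_eq_mul]
    ring
  rw [hq, hD, div_mul_eq_mul_div, mul_div_assoc', mul_left_comm, ← Real.exp_add, mul_assoc, ← Real.exp_add, hc]
  congr 3
  ring

lemma aux_step (V : Type*) (h : auxP V) : auxP (V ⊕ Unit) := by
  intro i1 i2 W hW hW0 θ η hθ hη
  have : Fintype V := Fintype.ofInjective (Sum.inl : V → V ⊕ Unit) Sum.inl_injective
  have : DecidableEq V := Classical.decEq V
  obtain rfl : i1 = instFintypeSum V Unit := Subsingleton.elim _ _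
  obtain rfl : i2 = instDecidableEqSum := Subsingleton.elim _ _
  have hmp := volume_measurePreserving_sumPiEquivProdPi_symm (fun _ : V ⊕ Unit => ℝ)
  rw [← hmp.lintegral_comp_emb (MeasurableEquiv.measurableEmbedding _)]
  rw [Measure.volume_eq_prod, lintegral_prod _ (by
    exact ((aux_Fmeas W hW θ η).comp (MeasurableEquiv.measurable _)).aemeasurable)]
  have hin : ∀ x : V → ℝ, ∫⁻ y : Unit → ℝ, auxF W θ η ((MeasurableEquiv.sumPiEquivProdPi (fun _ : V ⊕ Unit => ℝ)).symm (x, y))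
     = ∫⁻ t : ℝ, auxF W θ η (Sum.elim x (fun _ => t)) := by
    intro x
    have hmp2 := (volume_preserving_funUnique Unit ℝ).symm
    rw [← hmp2.lintegral_comp_emb (MeasurableEquiv.measurableEmbedding _)]
    refine lintegral_congr fun t => congrArg (auxF W θ η) ?_
    ext i
    rcases i with i | i <;> rfl
  simp_rw [hin, aux_inner W hW hW0 θ η hθ hη]
  have hWs : W.toBlocks₁₁.IsSymm := by
    ext i j
    exact hW.apply _ _
  rw [lintegral_const_mul _ (aux_Fmeas _ hWs _ _), h W.toBlocks₁₁ hWs (fun i j => hW0 _ _) (θ ∘ Sum.inl)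
    ((η ∘ Sum.inl) + θ (Sum.inr ()) • (fun i => W (Sum.inl i) (Sum.inr ()))) (fun i => hθ _)
    (fun i => add_nonneg (hη _) (mul_nonneg (hθ _).le (hW0 _ _)))]
  have hpos : 0 < θ (Sum.inr ()) := hθ _
  rw [← ENNReal.ofReal_mul (by positivity)]
  congr 1
  rw [Fintype.card_sum, Fintype.prod_sum_type]
  simp only [Fintype.card_unit, Finset.univ_unique, Finset.prod_singleton, Function.comp_apply]
  have hd : η ⬝ᵥ θ = (η ∘ Sum.inl) ⬝ᵥ (θ ∘ Sum.inl) + η (Sum.inr ()) * θ (Sum.inr ()) := by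
    simp [dotProduct]
  rw [hd, add_dotProduct, smul_dotProduct, smul_eq_mul]
  change _ = _ / (_ * θ (Sum.inr ()))
  rw [div_mul_eq_mul_div, div_mul_div_comm, mul_mul_mul_comm, ← Real.exp_add, pow_succ, mul_comm (Real.sqrt _), mul_comm (θ (Sum.inr ())) (∏ x, _)]
  congr 3
  ring

lemma aux_total (V : Type*) [Finite V] : auxP V := by
  refine Finite.induction_empty_option (P := fun V => auxP V) ?_ ?_ ?_ V
  · intro α β e h; exact aux_equiv e h
  · exact aux_empty _
  · intro α _ h
    exact aux_equiv (Equiv.optionEquivSumPUnit α).symm (aux_step α h)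

lemma aux_schur [Fintype V] [DecidableEq V] (M E : Matrix V V ℝ) (hM : M.PosDef) (hE : E.PosDef) :
    (E⁻¹ - M⁻¹).PosDef ↔ (M - E).PosDef := by
  have uM := (isUnit_iff_isUnit_det _).1 hM.isUnit
  have uE := (isUnit_iff_isUnit_det _).1 hE.isUnit
  let := hM.isUnit.invertible
  let := hE.inv.isUnit.invertible
  have h1 := PosDef.fromBlocks₁₁ (1 : Matrix V V ℝ) E⁻¹ hM
  have h2 := PosDef.fromBlocks₂₂ M (1 : Matrix V V ℝ) hE.inv
  rw [h1] at h2
  simp only [conjTranspose_one, Matrix.one_mul, Matrix.mul_one, nonsing_inv_nonsing_inv _ uE] at h2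
  have hdet : (M - E).det = E.det * (E⁻¹ - M⁻¹).det * M.det := by
    rw [← det_mul, ← det_mul]
    congr 1
    rw [Matrix.mul_sub, mul_nonsing_inv _ uE, Matrix.sub_mul, Matrix.one_mul, Matrix.mul_assoc,
      nonsing_inv_mul _ uM, Matrix.mul_one]
  constructor
  · intro h
    refine (h2.1 h.posSemidef).posDef_iff_det_ne_zero.2 ?_
    rw [hdet]
    exact mul_ne_zero (mul_ne_zero hE.det_pos.ne' h.det_pos.ne') hM.det_pos.ne'
  · intro h
    refine (h2.2 h.posSemidef).posDef_iff_det_ne_zero.2 ?_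
    have := h.det_pos.ne'
    rw [hdet] at this
    intro h0
    rw [h0] at this
    simp at this

lemma aux_Wt1 [Fintype V] [DecidableEq V] (W : Matrix V V ℝ) (T : V → ℝ)
    (hHT : (Matrix.diagonal (fun i => 1 / T i) - W).PosDef) :
    W + W * (Matrix.diagonal (fun i => 1 / T i) - W)⁻¹ * W =
      W * (Matrix.diagonal (fun i => 1 / T i) - W)⁻¹ * Matrix.diagonal (fun i => 1 / T i) := by
  have u := (isUnit_iff_isUnit_det _).1 hHT.isUnit
  set M := Matrix.diagonal (fun i => 1 / T i) - W with hM
  have : Matrix.diagonal (fun i => 1 / T i) = M + W := by rw [hM]; abel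
  rw [this, Matrix.mul_add, Matrix.mul_assoc W M⁻¹ M, nonsing_inv_mul _ u, Matrix.mul_one]

lemma aux_Wt2 [Fintype V] [DecidableEq V] (W : Matrix V V ℝ) (T : V → ℝ)
    (hHT : (Matrix.diagonal (fun i => 1 / T i) - W).PosDef) :
    Matrix.diagonal (fun i => 1 / T i) * (Matrix.diagonal (fun i => 1 / T i) - W)⁻¹ * Matrix.diagonal (fun i => 1 / T i) =
    Matrix.diagonal (fun i => 1 / T i) + (W + W * (Matrix.diagonal (fun i => 1 / T i) - W)⁻¹ * W) := by
  rw [aux_Wt1 W T hHT]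
  have u := (isUnit_iff_isUnit_det _).1 hHT.isUnit
  set M := Matrix.diagonal (fun i => 1 / T i) - W with hM
  set D := Matrix.diagonal (fun i => 1 / T i)
  have : D * M⁻¹ = 1 + W * M⁻¹ := by
    have : D = M + W := by rw [hM]; abel
    rw [this, Matrix.add_mul, mul_nonsing_inv _ u]
  rw [this, Matrix.add_mul, Matrix.one_mul]

lemma aux_Ht [Fintype V] [DecidableEq V] (W : Matrix V V ℝ) (T : V → ℝ) (hT : ∀ i, 0 < T i)
    (hHT : (Matrix.diagonal (fun i => 1 / T i) - W).PosDef) (β : V → ℝ) (hβ : ∀ i, 2 * T i * β i < 1) :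
    Hmat (W + W * (Matrix.diagonal (fun i => 1 / T i) - W)⁻¹ * W) (fun i => β i / (1 - 2 * T i * β i)) =
      Matrix.diagonal (fun i => 1 / T i) * ((Matrix.diagonal (fun i => 1 / T i - 2 * β i))⁻¹ -
        (Matrix.diagonal (fun i => 1 / T i) - W)⁻¹) * Matrix.diagonal (fun i => 1 / T i) := by
  have hinv : (Matrix.diagonal (fun i => 1 / T i - 2 * β i))⁻¹ = Matrix.diagonal (fun i => T i / (1 - 2 * T i * β i)) := by
    refine inv_eq_right_inv ?_
    rw [diagonal_mul_diagonal, ← diagonal_one]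
    congr 1
    ext i
    have := hT i
    have h2 : 1 - 2 * T i * β i ≠ 0 := by linarith [hβ i]
    have h3 : 1 - T i * 2 * β i ≠ 0 := by linarith [hβ i]
    field_simp
  rw [Matrix.mul_sub, Matrix.sub_mul, aux_Wt2 W T hHT, hinv, diagonal_mul_diagonal, diagonal_mul_diagonal, Hmat]
  have : (diagonal fun i => 2 * (β i / (1 - 2 * T i * β i))) =
      (diagonal fun i => 1 / T i * (T i / (1 - 2 * T i * β i)) * (1 / T i)) - (diagonal fun i => 1 / T i) := by
    rw [diagonal_sub]
    congr 1
    ext i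
    have := hT i
    have h2 : 1 - 2 * T i * β i ≠ 0 := by linarith [hβ i]
    obtain ⟨d, hd⟩ : ∃ d, d = 1 - 2 * T i * β i := ⟨_, rfl⟩
    have hb : β i = (1 - d) / (2 * T i) := by
      rw [hd]; field_simp; ring
    rw [← hd] at h2 ⊢
    rw [hb]
    field_simp
  rw [this, sub_sub]

lemma aux_pd_iff [Fintype V] [DecidableEq V] (W : Matrix V V ℝ) (T : V → ℝ) (hT : ∀ i, 0 < T i)
    (hHT : (Matrix.diagonal (fun i => 1 / T i) - W).PosDef) (β : V → ℝ) (hβ : ∀ i, 2 * T i * β i < 1) :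
    (Hmat (W + W * (Matrix.diagonal (fun i => 1 / T i) - W)⁻¹ * W) (fun i => β i / (1 - 2 * T i * β i))).PosDef ↔
      (Hmat W β).PosDef := by
  have hE : (Matrix.diagonal (fun i => 1 / T i - 2 * β i)).PosDef := by
    refine PosDef.diagonal fun i => ?_
    have := hT i
    have h2 := hβ i
    have : 1 / T i - 2 * β i = (1 - 2 * T i * β i) / T i := by field_simp
    rw [this]
    apply div_pos <;> linarith
  have hu : IsUnit (Matrix.diagonal (fun i => 1 / T i)) := by
    refine (PosDef.diagonal fun i => ?_ : (Matrix.diagonal (fun i => 1 / T i)).PosDef).isUnit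
    have := hT i
    positivity
  rw [aux_Ht W T hT hHT β hβ]
  have h3 := Matrix.IsUnit.posDef_star_left_conjugate_iff (x := (Matrix.diagonal (fun i => 1 / T i - 2 * β i))⁻¹ -
        (Matrix.diagonal (fun i => 1 / T i) - W)⁻¹) hu
  have hs : star (Matrix.diagonal (fun i => 1 / T i)) = Matrix.diagonal (fun i => 1 / T i) := by
    rw [star_eq_conjTranspose, diagonal_conjTranspose]; congr 1
  rw [hs] at h3
  rw [h3, aux_schur _ _ hHT hE]
  have : Matrix.diagonal (fun i => 1 / T i) - W - Matrix.diagonal (fun i => 1 / T i - 2 * β i) = Hmat W β := by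
    rw [sub_right_comm, diagonal_sub, Hmat]
    congr 2; ext i; ring
  rw [this]

lemma aux_fac [Fintype V] [DecidableEq V] (W : Matrix V V ℝ) (T : V → ℝ) (hT : ∀ i, 0 < T i)
    (hHT : (Matrix.diagonal (fun i => 1 / T i) - W).PosDef) (β : V → ℝ) (hβ : ∀ i, 2 * T i * β i < 1) :
    Hmat W β = Matrix.diagonal (fun i => 1 - 2 * T i * β i) *
      Hmat (W + W * (Matrix.diagonal (fun i => 1 / T i) - W)⁻¹ * W) (fun i => β i / (1 - 2 * T i * β i)) *
      (1 - Matrix.diagonal T * W) := by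
  have u := (isUnit_iff_isUnit_det _).1 hHT.isUnit
  have hK : 1 - Matrix.diagonal T * W = Matrix.diagonal T * (Matrix.diagonal (fun i => 1 / T i) - W) := by
    rw [Matrix.mul_sub, diagonal_mul_diagonal, ← diagonal_one]
    congr 2; ext i
    have := (hT i).ne'
    field_simp
  have hWt : (W + W * (Matrix.diagonal (fun i => 1 / T i) - W)⁻¹ * W) * (1 - Matrix.diagonal T * W) = W := by
    rw [hK, aux_Wt1 W T hHT]
    set M := Matrix.diagonal (fun i => 1 / T i) - W
    have : Matrix.diagonal (fun i => 1 / T i) * Matrix.diagonal T = 1 := by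
      rw [diagonal_mul_diagonal, ← diagonal_one]
      congr 1; ext i
      have := (hT i).ne'
      field_simp
    calc W * M⁻¹ * diagonal (fun i => 1 / T i) * (diagonal T * M)
        = W * M⁻¹ * (diagonal (fun i => 1 / T i) * diagonal T) * M := by simp only [Matrix.mul_assoc]
      _ = W := by rw [this, Matrix.mul_one, Matrix.mul_assoc, nonsing_inv_mul _ u, Matrix.mul_one]
  rw [Matrix.mul_assoc]
  conv_rhs => rw [Hmat, Matrix.sub_mul, hWt, Matrix.mul_sub, ← Matrix.mul_assoc, diagonal_mul_diagonal, Matrix.mul_sub, Matrix.mul_one,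
    ← Matrix.mul_assoc, diagonal_mul_diagonal]
  rw [Hmat]
  ext i j
  have h2 : 1 - 2 * T i * β i ≠ 0 := by linarith [hβ i]
  have e : (1 - 2 * T i * β i) * (2 * (β i / (1 - 2 * T i * β i))) = 2 * β i := by
    rw [mul_left_comm, mul_div_cancel₀ _ h2]
  simp only [Matrix.sub_apply, diagonal_mul, diagonal_apply, e]
  split_ifs <;> ring

lemma aux_etat [Fintype V] [DecidableEq V] (W : Matrix V V ℝ) (T : V → ℝ) (hT : ∀ i, 0 < T i)
    (hHT : (Matrix.diagonal (fun i => 1 / T i) - W).PosDef) (η : V → ℝ) :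
    (W + W * (Matrix.diagonal (fun i => 1 / T i) - W)⁻¹ * W) *ᵥ (Matrix.diagonal T *ᵥ η) + η =
      W *ᵥ ((Matrix.diagonal (fun i => 1 / T i) - W)⁻¹ *ᵥ η) + η := by
  have : Matrix.diagonal (fun i => 1 / T i) * Matrix.diagonal T = 1 := by
    rw [diagonal_mul_diagonal, ← diagonal_one]
    congr 1; ext i
    have := (hT i).ne'
    field_simp
  rw [aux_Wt1 W T hHT, mulVec_mulVec, Matrix.mul_assoc, this, Matrix.mul_one, mulVec_mulVec]

lemma aux_quadT [Fintype V] [DecidableEq V] (W : Matrix V V ℝ) (hW : W.IsSymm) (T : V → ℝ) (hT : ∀ i, 0 < T i)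
    (hHT : (Matrix.diagonal (fun i => 1 / T i) - W).PosDef) (β : V → ℝ) (hβ : ∀ i, 2 * T i * β i < 1)
    (hH : (Hmat W β).PosDef) (η ηt : V → ℝ)
    (hηt : ηt = (W + W * (Matrix.diagonal (fun i => 1 / T i) - W)⁻¹ * W) *ᵥ (Matrix.diagonal T *ᵥ η) + η) :
    η ⬝ᵥ (Hmat W β)⁻¹ *ᵥ η = ηt ⬝ᵥ (Hmat (W + W * (Matrix.diagonal (fun i => 1 / T i) - W)⁻¹ * W) (fun i => β i / (1 - 2 * T i * β i)))⁻¹ *ᵥ ηt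
      + η ⬝ᵥ (Matrix.diagonal (fun i => 1 / T i) - W)⁻¹ *ᵥ η := by
  have hHt := (aux_pd_iff W T hT hHT β hβ).2 hH
  have hfac := aux_fac W T hT hHT β hβ
  have heta := aux_etat W T hT hHT η
  have u := (isUnit_iff_isUnit_det _).1 hHT.isUnit
  have ut := (isUnit_iff_isUnit_det _).1 hHt.isUnit
  have hK : 1 - Matrix.diagonal T * W = Matrix.diagonal T * (Matrix.diagonal (fun i => 1 / T i) - W) := by
    rw [Matrix.mul_sub, diagonal_mul_diagonal, ← diagonal_one]
    congr 2; ext i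
    have := (hT i).ne'
    field_simp
  have hMs : (Matrix.diagonal (fun i => 1 / T i) - W)⁻¹.IsSymm := by
    have := hHT.inv.isHermitian
    simpa [IsHermitian, IsSymm, conjTranspose_eq_transpose_of_trivial] using this
  have hTD : diagonal T * diagonal (fun i => 1 / T i) = 1 := by
    rw [diagonal_mul_diagonal, ← diagonal_one]
    congr 1; ext i
    have := (hT i).ne'
    field_simp
  set Wt := W + W * (Matrix.diagonal (fun i => 1 / T i) - W)⁻¹ * W with hWt
  set M := Matrix.diagonal (fun i => 1 / T i) - W with hM
  set D := Matrix.diagonal (fun i => 1 / T i) with hD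
  set Ht := Hmat Wt (fun i => β i / (1 - 2 * T i * β i)) with hHtdef
  set y := Ht⁻¹ *ᵥ ηt with hy
  have hHy : Ht *ᵥ y = ηt := by rw [hy, mulVec_mulVec, mul_nonsing_inv _ ut, one_mulVec]
  have hx := aux_inv_quad _ hH.isUnit (M⁻¹ *ᵥ (D *ᵥ y) + M⁻¹ *ᵥ η) η (by
    have hKx : (1 - Matrix.diagonal T * W) *ᵥ (M⁻¹ *ᵥ (D *ᵥ y) + M⁻¹ *ᵥ η) = y + diagonal T *ᵥ η := by
      rw [hK, ← mulVec_add, mulVec_mulVec, Matrix.mul_assoc, mul_nonsing_inv _ u, Matrix.mul_one, mulVec_add, mulVec_mulVec, hTD,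
        one_mulVec]
    rw [hfac, ← mulVec_mulVec, hKx, ← mulVec_mulVec, mulVec_add, hHy, hηt, hHtdef, Hmat, sub_mulVec]
    ext i
    have h2 : 1 - 2 * T i * β i ≠ 0 := by linarith [hβ i]
    have h3 : 1 - T i * 2 * β i ≠ 0 := by linarith [hβ i]
    simp only [mulVec_diagonal, Pi.add_apply, Pi.sub_apply]
    field_simp
    ring)
  rw [hx, dotProduct_add]
  congr 1
  have e : D = M + W := by rw [hM]; abel
  rw [e, add_mulVec, mulVec_add, mulVec_mulVec, nonsing_inv_mul _ u, one_mulVec, dotProduct_add, hηt, heta, add_dotProduct, add_comm]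
  congr 1
  rw [aux_symm _ hMs, dotProduct_comm (W *ᵥ _) y, dotProduct_comm (W *ᵥ y), aux_symm W hW, dotProduct_comm]

lemma aux_Hquad [Fintype V] [DecidableEq V] (W : Matrix V V ℝ) (β θ : V → ℝ) :
    θ ⬝ᵥ Hmat W β *ᵥ θ = 2 * (∑ i, θ i ^ 2 * β i) - θ ⬝ᵥ W *ᵥ θ := by
  rw [Hmat, sub_mulVec, dotProduct_sub]
  congr 1
  simp only [dotProduct, mulVec_diagonal, Finset.mul_sum]
  refine Finset.sum_congr rfl fun i _ => ?_
  ring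

lemma aux_cov [Fintype V] [DecidableEq V] (T : V → ℝ) (S : Set (V → ℝ)) (hS : MeasurableSet S)
    (hS1 : ∀ β ∈ S, ∀ i, 2 * T i * β i < 1) (g : (V → ℝ) → ENNReal) :
    ∫⁻ b in (fun β : V → ℝ => fun i => β i / (1 - 2 * T i * β i)) '' S, g b =
      ∫⁻ β in S, ENNReal.ofReal (∏ i, 1 / (1 - 2 * T i * β i)^2) * g (fun i => β i / (1 - 2 * T i * β i)) := by
  have h := lintegral_image_eq_lintegral_abs_det_fderiv_mul (volume : Measure (V → ℝ)) hS
    (f := fun β : V → ℝ => fun i => β i / (1 - 2 * T i * β i))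
    (f' := fun β => LinearMap.toContinuousLinearMap (Matrix.toLin' (diagonal fun i => 1 / (1 - 2 * T i * β i)^2)))
    (by
      intro β hβ
      refine HasFDerivAt.hasFDerivWithinAt ?_
      rw [hasFDerivAt_pi']
      intro i
      have h2 : 1 - 2 * T i * β i ≠ 0 := by linarith [hS1 β hβ i]
      have hd : HasDerivAt (fun x : ℝ => x / (1 - 2 * T i * x)) (1 / (1 - 2 * T i * β i)^2) (β i) := by
        have := (hasDerivAt_id (β i)).div (((hasDerivAt_id (β i)).const_mul (2 * T i)).const_sub 1) h2
        refine this.congr_deriv ?_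
        simp only [id]
        congr 1
        ring
      have := hd.comp_hasFDerivAt β (hasFDerivAt_apply (𝕜 := ℝ) i β)
      refine this.congr_fderiv ?_
      ext v
      simp [mulVec_diagonal])
    (by
      intro β hβ β' hβ' hh
      ext i
      have h1 : 1 - 2 * T i * β i ≠ 0 := by linarith [hS1 β hβ i]
      have h2 : 1 - 2 * T i * β' i ≠ 0 := by linarith [hS1 β' hβ' i]
      have := congrFun hh i
      simp only at this
      rw [div_eq_div_iff h1 h2] at this
      linarith)
    g
  rw [h]
  refine setLIntegral_congr_fun hS fun β hβ => ?_
  have : ((LinearMap.toContinuousLinearMap (Matrix.toLin' (diagonal fun i => 1 / (1 - 2 * T i * β i)^2))).det) =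
      ∏ i, 1 / (1 - 2 * T i * β i)^2 := by
    rw [LinearMap.det_toContinuousLinearMap, LinearMap.det_toLin', det_diagonal]
  simp only [this]
  rw [abs_of_nonneg (Finset.prod_nonneg fun i _ => by positivity)]


lemma aux_prodpow [Fintype V] (d : V → ℝ) (hd : ∀ i, 0 < d i) :
    ∏ i, (d i) ^ (-(3 : ℝ) / 2) = (∏ i, 1 / (d i)^2) * Real.sqrt (∏ i, d i) := by
  rw [Real.sqrt_eq_rpow, ← Real.finsetProd_rpow _ _ (fun i _ => (hd i).le), ← Finset.prod_mul_distrib]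
  refine Finset.prod_congr rfl fun i _ => ?_
  rw [show (-(3:ℝ)/2) = -2 + 1/2 by norm_num, Real.rpow_add (hd i), Real.rpow_neg (hd i).le]
  norm_num

lemma aux_densmeas [Fintype V] [DecidableEq V] (W : Matrix V V ℝ) (hW : W.IsSymm) (θ η : V → ℝ) :
    Measurable (nuDensity W θ η) := by
  unfold nuDensity
  refine Measurable.indicator ?_ (aux_Fset W hW)
  have h1 := aux_measQ _ (aux_Hmeas W) θ
  have h2 := aux_measQ _ (aux_measInv _ (aux_Hmeas W)) η
  have h3 := aux_measDet _ (aux_Hmeas W)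
  fun_prop

/-- The key integral computation expressing `D(u)` in the second proof of the
multi-dimensional opposite drift theorem. -/
theorem nu_integral_Du [Fintype V] [DecidableEq V] [Nonempty V]
    (W : Matrix V V ℝ) (hWsymm : W.IsSymm) (hWpos : ∀ i j, 0 ≤ W i j)
    (θ η : V → ℝ) (hθ : ∀ i, 0 < θ i) (hη : ∀ i, 0 ≤ η i)
    (θ' T : V → ℝ) (hθ' : ∀ i, 0 < θ' i) (hT : ∀ i, 0 < T i)
    (hHT : (Matrix.diagonal (fun i => 1 / T i) - W).PosDef) :
    ∫ β, (if ∀ i, 2 * T i * β i < 1 then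
        Real.exp (∑ i, (θ i ^ 2 * β i - β i * θ' i ^ 2 / (1 - 2 * T i * β i))) *
          ∏ i, (1 - 2 * T i * β i) ^ (-(3 : ℝ) / 2)
      else 0) ∂(nu W θ η) =
      Real.exp (-(1 / 2) * (θ' ⬝ᵥ
            (W + W * (Matrix.diagonal (fun i => 1 / T i) - W)⁻¹ * W) *ᵥ θ')
          - (1 / 2) * (η ⬝ᵥ (Matrix.diagonal (fun i => 1 / T i) - W)⁻¹ *ᵥ η)
          - (((W + W * (Matrix.diagonal (fun i => 1 / T i) - W)⁻¹ * W) *ᵥ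
              (Matrix.diagonal T *ᵥ η) + η) ⬝ᵥ θ')
          + (1 / 2) * (θ ⬝ᵥ W *ᵥ θ) + η ⬝ᵥ θ) *
        (∏ i, θ i / θ' i) / Real.sqrt (1 - Matrix.diagonal T * W).det := by
  have hpd := aux_pd_iff W T hT hHT
  have hfac := aux_fac W T hT hHT
  have hquad := fun β hβ hH => aux_quadT W hWsymm T hT hHT β hβ hH η _ rfl
  have heta := aux_etat W T hT hHT η
  have hMoff : ∀ i j, i ≠ j → (Matrix.diagonal (fun i => 1 / T i) - W) i j ≤ 0 := fun i j hij => by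
    simp [diagonal_apply_ne _ hij, hWpos]
  have hMs : (Matrix.diagonal (fun i => 1 / T i) - W)⁻¹.IsSymm := by
    have := hHT.inv.isHermitian
    simpa [IsHermitian, IsSymm, conjTranspose_eq_transpose_of_trivial] using this
  have hMinv := aux_Minv _ hHT hMoff
  have hdetK : 0 < (1 - Matrix.diagonal T * W).det := by
    have hK : 1 - Matrix.diagonal T * W = Matrix.diagonal T * (Matrix.diagonal (fun i => 1 / T i) - W) := by
      rw [Matrix.mul_sub, diagonal_mul_diagonal, ← diagonal_one]
      congr 2; ext i
      have := (hT i).ne'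
      field_simp
    rw [hK, det_mul, det_diagonal]
    exact mul_pos (Finset.prod_pos fun i _ => hT i) hHT.det_pos
  set M := Matrix.diagonal (fun i => 1 / T i) - W with hM
  set Wt := W + W * M⁻¹ * W with hWt
  set ηt := Wt *ᵥ (Matrix.diagonal T *ᵥ η) + η with hηt
  have hWts : Wt.IsSymm := by
    rw [IsSymm, hWt, transpose_add, transpose_mul, transpose_mul, hWsymm.eq, hMs.eq, Matrix.mul_assoc]
  have hWt0 : ∀ i j, 0 ≤ Wt i j := by
    intro i j
    rw [hWt, Matrix.mul_assoc, Matrix.add_apply, Matrix.mul_apply]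
    refine add_nonneg (hWpos _ _) (Finset.sum_nonneg fun k _ => mul_nonneg (hWpos _ _) ?_)
    exact hMinv (fun l => W l j) (fun l => hWpos _ _) k
  have hηt0 : ∀ i, 0 ≤ ηt i := by
    intro i
    rw [heta]
    exact add_nonneg (Finset.sum_nonneg fun k _ => mul_nonneg (hWpos _ _) (hMinv η hη k)) (hη i)
  set φ : (V → ℝ) → (V → ℝ) := fun β i => β i / (1 - 2 * T i * β i) with hφ
  set S : Set (V → ℝ) := {β | ∀ i, 2 * T i * β i < 1} ∩ {β | (Hmat W β).PosDef} with hSdef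
  have hS1 : MeasurableSet {β : V → ℝ | ∀ i, 2 * T i * β i < 1} := by
    have : {β : V → ℝ | ∀ i, 2 * T i * β i < 1} = ⋂ i, {β : V → ℝ | 2 * T i * β i < 1} := by
      ext β; simp
    rw [this]
    exact MeasurableSet.iInter fun i => measurableSet_lt (by fun_prop) (by fun_prop)
  have hS : MeasurableSet S := hS1.inter (aux_Fset W hWsymm)
  have hcov := aux_cov T S hS (fun β hβ => hβ.1) (auxF Wt θ' ηt)
  have himg : φ '' S = {b | (Hmat Wt b).PosDef} := by
    ext b
    constructor
    · rintro ⟨β, hβ, rfl⟩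
      exact (hpd β hβ.1).2 hβ.2
    · intro hb
      have hb' : (Hmat Wt b).PosDef := hb
      have hb0 : ∀ i, 0 < b i := fun i => by
        have := hb'.diag_pos (i := i)
        simp only [Hmat, Matrix.sub_apply, diagonal_apply_eq] at this
        have := hWt0 i i
        linarith
      have hd : ∀ i, 0 < 1 + 2 * T i * b i := fun i => by
        have := hb0 i
        have := hT i
        positivity
      have hd2 : ∀ i, 1 - 2 * T i * (b i / (1 + 2 * T i * b i)) = 1 / (1 + 2 * T i * b i) := fun i => by
        have := (hd i).ne'
        rw [mul_div_assoc', eq_div_iff this, sub_mul, div_mul_cancel₀ _ this]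
        ring
      have h1 : ∀ i, 2 * T i * (b i / (1 + 2 * T i * b i)) < 1 := fun i => by
        have := one_div_pos.2 (hd i)
        rw [← hd2] at this
        linarith
      have h2 : φ (fun i => b i / (1 + 2 * T i * b i)) = b := by
        ext i
        simp only [hφ, hd2]
        have := (hd i).ne'
        rw [div_div_div_cancel_right₀ this, div_one]
      refine ⟨fun i => b i / (1 + 2 * T i * b i), ⟨h1, ?_⟩, h2⟩
      have := hpd (fun i => b i / (1 + 2 * T i * b i)) h1
      refine this.1 ?_
      change (Hmat Wt (φ (fun i => b i / (1 + 2 * T i * b i)))).PosDef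
      rw [h2]; exact hb'
  change ∫⁻ b in φ '' S, auxF Wt θ' ηt b = ∫⁻ β in S, ENNReal.ofReal (∏ i, 1 / (1 - 2 * T i * β i)^2) * auxF Wt θ' ηt (φ β) at hcov
  have htot : ∫⁻ b in φ '' S, auxF Wt θ' ηt b =
      ENNReal.ofReal (Real.sqrt (Real.pi/2) ^ (Fintype.card V) * Real.exp (-(ηt ⬝ᵥ θ')) / ∏ i, θ' i) := by
    rw [← aux_total V Wt hWts hWt0 θ' ηt hθ' hηt0, himg, ← lintegral_indicator (aux_Fset Wt hWts)]
    refine lintegral_congr fun b => ?_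
    by_cases hb : (Hmat Wt b).PosDef
    · rw [Set.indicator_of_mem (by exact hb)]
    · rw [Set.indicator_of_notMem (by exact hb), auxF, Set.indicator_of_notMem (by exact hb)]
  rw [htot] at hcov
  have hθp : 0 < ∏ i, θ i := Finset.prod_pos fun i _ => hθ i
  have hθp' : 0 < ∏ i, θ' i := Finset.prod_pos fun i _ => hθ' i
  set C := (2 / Real.pi) ^ ((Fintype.card V : ℝ) / 2) * (∏ i, θ i) / Real.sqrt (1 - Matrix.diagonal T * W).det *
    Real.exp ((1/2) * (θ ⬝ᵥ W *ᵥ θ) + η ⬝ᵥ θ - (1/2) * (θ' ⬝ᵥ Wt *ᵥ θ') - (1/2) * (η ⬝ᵥ M⁻¹ *ᵥ η)) with hC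
  have hC0 : 0 ≤ C := by have := Real.pi_pos; positivity
  set g : (V → ℝ) → ℝ := fun β => (if ∀ i, 2 * T i * β i < 1 then
        Real.exp (∑ i, (θ i ^ 2 * β i - β i * θ' i ^ 2 / (1 - 2 * T i * β i))) *
          ∏ i, (1 - 2 * T i * β i) ^ (-(3 : ℝ) / 2)
      else 0) with hg
  have hg0 : ∀ β, 0 ≤ g β := by
    intro β
    simp only [hg]
    split_ifs with h
    · refine mul_nonneg (Real.exp_pos _).le (Finset.prod_nonneg fun i _ => Real.rpow_nonneg ?_ _)
      linarith [h i]
    · exact le_rfl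
  have hgm : Measurable g := by
    refine Measurable.ite hS1 ?_ measurable_const
    fun_prop
  have hpt : ∀ β, ENNReal.ofReal (nuDensity W θ η β) * ENNReal.ofReal (g β) =
      S.indicator (fun β => ENNReal.ofReal C * (ENNReal.ofReal (∏ i, 1 / (1 - 2 * T i * β i)^2) * auxF Wt θ' ηt (φ β))) β := by
    intro β
    by_cases hβ : ∀ i, 2 * T i * β i < 1
    swap
    · rw [Set.indicator_of_notMem (fun h => hβ h.1)]
      simp only [hg]
      rw [if_neg hβ]; simp
    by_cases hH : (Hmat W β).PosDef
    swap
    · rw [Set.indicator_of_notMem (fun h => hH h.2)]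
      have : nuDensity W θ η β = 0 := Set.indicator_of_notMem (by exact hH) _
      rw [this]; simp
    have hmem : β ∈ S := ⟨hβ, hH⟩
    rw [Set.indicator_of_mem hmem]
    have hHt : (Hmat Wt (φ β)).PosDef := (hpd β hβ).2 hH
    have e1 : nuDensity W θ η β = _ := Set.indicator_of_mem (by exact hH) _
    have e2 : auxF Wt θ' ηt (φ β) = _ := Set.indicator_of_mem (by exact hHt) _
    have e3 : g β = _ := if_pos hβ
    have hd : ∀ i, 0 < 1 - 2 * T i * β i := fun i => by linarith [hβ i]
    have hdp : 0 < ∏ i, (1 - 2 * T i * β i) := Finset.prod_pos fun i _ => hd i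
    have hdet : (Hmat W β).det = (∏ i, (1 - 2 * T i * β i)) * (Hmat Wt (φ β)).det * (1 - Matrix.diagonal T * W).det := by
      rw [hfac β hβ, det_mul, det_mul, det_diagonal]
    have hD : 0 ≤ nuDensity W θ η β := by
      rw [e1]
      have := Real.pi_pos
      positivity
    rw [← ENNReal.ofReal_mul hD, e1, e2, e3, ← ENNReal.ofReal_mul (Finset.prod_nonneg fun i _ => by positivity),
      ← ENNReal.ofReal_mul hC0]
    congr 1
    rw [aux_prodpow _ hd, hdet, Real.sqrt_mul (mul_pos hdp hHt.det_pos).le, Real.sqrt_mul hdp.le, hC]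
    have hsum : ∑ i, (θ i ^ 2 * β i - β i * θ' i ^ 2 / (1 - 2 * T i * β i)) =
        (∑ i, θ i ^ 2 * β i) - ∑ i, θ' i ^ 2 * φ β i := by
      rw [← Finset.sum_sub_distrib]
      refine Finset.sum_congr rfl fun i _ => ?_
      simp only [hφ]; ring
    have q1 := aux_Hquad W β θ
    have q2 := aux_Hquad Wt (φ β) θ'
    have q3 : η ⬝ᵥ (Hmat W β)⁻¹ *ᵥ η = ηt ⬝ᵥ (Hmat Wt (φ β))⁻¹ *ᵥ ηt + η ⬝ᵥ M⁻¹ *ᵥ η := hquad β hβ hH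
    rw [hsum, q1, q2, q3]
    have hexp : Real.exp (-(1 / 2) * (2 * ∑ i, θ i ^ 2 * β i - θ ⬝ᵥ W *ᵥ θ) -
        1 / 2 * (ηt ⬝ᵥ (Hmat Wt (φ β))⁻¹ *ᵥ ηt + η ⬝ᵥ M⁻¹ *ᵥ η) + η ⬝ᵥ θ) *
        Real.exp ((∑ i, θ i ^ 2 * β i) - ∑ i, θ' i ^ 2 * φ β i) =
        Real.exp ((1/2) * (θ ⬝ᵥ W *ᵥ θ) + η ⬝ᵥ θ - (1/2) * (θ' ⬝ᵥ Wt *ᵥ θ') - (1/2) * (η ⬝ᵥ M⁻¹ *ᵥ η)) *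
        Real.exp (-(1 / 2) * (2 * ∑ i, θ' i ^ 2 * φ β i - θ' ⬝ᵥ Wt *ᵥ θ') -
        1 / 2 * (ηt ⬝ᵥ (Hmat Wt (φ β))⁻¹ *ᵥ ηt)) := by
      rw [← Real.exp_add, ← Real.exp_add]
      congr 1; ring
    have s1 : Real.sqrt (∏ i, (1 - 2 * T i * β i)) ≠ 0 := (Real.sqrt_pos.2 hdp).ne'
    have s2 : Real.sqrt (Hmat Wt (φ β)).det ≠ 0 := (Real.sqrt_pos.2 hHt.det_pos).ne'
    have s3 : Real.sqrt (1 - Matrix.diagonal T * W).det ≠ 0 := (Real.sqrt_pos.2 hdetK).ne'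
    generalize Real.sqrt (∏ i, (1 - 2 * T i * β i)) = r1 at *
    generalize Real.sqrt (Hmat Wt (φ β)).det = r2 at *
    generalize Real.sqrt (1 - Matrix.diagonal T * W).det = r3 at *
    generalize (∏ i, 1 / (1 - 2 * T i * β i)^2) = r4 at *
    generalize (2 / Real.pi) ^ ((Fintype.card V : ℝ) / 2) = r5 at *
    generalize (∏ i, θ i) = r6 at *
    generalize Real.exp (-(1 / 2) * (2 * ∑ i, θ i ^ 2 * β i - θ ⬝ᵥ W *ᵥ θ) -
        1 / 2 * (ηt ⬝ᵥ (Hmat Wt (φ β))⁻¹ *ᵥ ηt + η ⬝ᵥ M⁻¹ *ᵥ η) + η ⬝ᵥ θ) = x1 at *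
    generalize Real.exp ((∑ i, θ i ^ 2 * β i) - ∑ i, θ' i ^ 2 * φ β i) = x2 at *
    calc r5 * x1 * r6 / (r1 * r2 * r3) * (x2 * (r4 * r1)) = r5 * (x1 * x2) * r6 / (r2 * r3) * r4 := by
          field_simp
      _ = _ := by
          rw [hexp]
          field_simp
  rw [integral_eq_lintegral_of_nonneg_ae (Filter.Eventually.of_forall hg0) hgm.aestronglyMeasurable, nu,
    lintegral_withDensity_eq_lintegral_mul _ (aux_densmeas W hWsymm θ η).ennreal_ofReal hgm.ennreal_ofReal]
  have hfin : ∫⁻ β, ((fun β => ENNReal.ofReal (nuDensity W θ η β)) * fun β => ENNReal.ofReal (g β)) β =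
      ENNReal.ofReal C * ENNReal.ofReal (Real.sqrt (Real.pi/2) ^ (Fintype.card V) * Real.exp (-(ηt ⬝ᵥ θ')) / ∏ i, θ' i) := by
    simp only [Pi.mul_apply, hpt]
    rw [lintegral_indicator hS, lintegral_const_mul' _ _ ENNReal.ofReal_ne_top, hcov]
  rw [hfin, ← ENNReal.ofReal_mul hC0, ENNReal.toReal_ofReal (mul_nonneg hC0 (by positivity)), hC, Finset.prod_div_distrib]
  have hpi : (2 / Real.pi) ^ ((Fintype.card V : ℝ) / 2) * Real.sqrt (Real.pi/2) ^ (Fintype.card V) = 1 := by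
    have hp := Real.pi_pos
    rw [Real.sqrt_eq_rpow, ← Real.rpow_natCast, ← Real.rpow_mul (by positivity),
      show (1/2 * (Fintype.card V : ℝ)) = (Fintype.card V : ℝ)/2 by ring, ← Real.mul_rpow (by positivity) (by positivity)]
    have : 2 / Real.pi * (Real.pi / 2) = 1 := by field_simp
    rw [this, Real.one_rpow]
  have hexp : Real.exp (-(1 / 2) * (θ' ⬝ᵥ Wt *ᵥ θ') - (1 / 2) * (η ⬝ᵥ M⁻¹ *ᵥ η) - (ηt ⬝ᵥ θ')
          + (1 / 2) * (θ ⬝ᵥ W *ᵥ θ) + η ⬝ᵥ θ) =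
      Real.exp ((1/2) * (θ ⬝ᵥ W *ᵥ θ) + η ⬝ᵥ θ - (1/2) * (θ' ⬝ᵥ Wt *ᵥ θ') - (1/2) * (η ⬝ᵥ M⁻¹ *ᵥ η)) *
      Real.exp (-(ηt ⬝ᵥ θ')) := by
    rw [← Real.exp_add]
    congr 1; ring
  rw [hexp]
  generalize (2 / Real.pi) ^ ((Fintype.card V : ℝ) / 2) = r5 at *
  generalize Real.sqrt (Real.pi/2) ^ (Fintype.card V) = r6 at *
  calc _ = (r5 * r6) * ((∏ i, θ i) / Real.sqrt (1 - Matrix.diagonal T * W).det *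
    Real.exp ((1/2) * (θ ⬝ᵥ W *ᵥ θ) + η ⬝ᵥ θ - (1/2) * (θ' ⬝ᵥ Wt *ᵥ θ') - (1/2) * (η ⬝ᵥ M⁻¹ *ᵥ η)) *
      Real.exp (-(ηt ⬝ᵥ θ')) / ∏ i, θ' i) := by ring
    _ = _ := by rw [hpi]; ring
end

section
/- Fix z ∈ (0,∞)^V. Define the measure μ₁ on ℝ^V × ℝ^V as follows: draw β according to ν_V^{W,θ,η+1/z} (where 1/z = (1/z_i)_{i∈V}); given β (which satisfies H_β positive definite a.s.), draw α according to ν_V^{W̃,θ̃,η̃} with W̃ = W + W·H_β^{−1}·W, η̃ = η + W·H_β^{−1}·η and θ̃_i = 1/(2β_i z_i); let μ₁ be the resulting law of the pair ((2β_i)_{i∈V}, ((2β_i)²/(2α_i))_{i∈V}). Define μ₂ on ℝ^V × ℝ^V as follows: draw δ according to ν_V^{W,θ,η}, independently draw A = (A_i)_{i∈V} with independent components where A_i has density t ↦ 1_{t>0} · 1/(z_i √(2π t³)) · exp(−(θ_i t − 1/z_i)²/(2t)) (the Inverse Gaussian IG(1/(θ_i z_i), 1/z_i²)); let μ₂ be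 the law of the pair ((2δ_i + A_i)_{i∈V}, (A_i + A_i²/(2δ_i))_{i∈V}). Then μ₁ = μ₂. -/
open MeasureTheory Matrix

variable {V : Type*}

section matrixpart
variable [Fintype V] [DecidableEq V]

lemma aux_HT (W H G B : Matrix V V ℝ) (a b : V → ℝ) (hB : B = diagonal b)
    (hH : H = B - W) (hGH : G * H = 1) (hHG : H * G = 1) :
    diagonal (fun i => b i ^ 2 / a i - b i) - (W + W * G * W)
      = B * (diagonal (fun i => (a i)⁻¹) - G) * B := by
  have hBW : B = H + W := by rw [hH]; abel
  have h1 : B * G * B = B + W + W * G * W := by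
    have : B * G * B = H * G * H + (H * G) * W + W * (G * H) + W * G * W := by
      rw [hBW]; noncomm_ring
    rw [this, hHG, hGH, hBW]; noncomm_ring
  have h2 : B * diagonal (fun i => (a i)⁻¹) * B = diagonal (fun i => b i ^ 2 / a i) := by
    rw [hB, diagonal_mul_diagonal, diagonal_mul_diagonal]
    congr 1; ext i; ring
  have h3 : diagonal (fun i => b i ^ 2 / a i - b i) = diagonal (fun i => b i ^ 2 / a i) - B := by
    rw [hB, diagonal_sub]
  rw [mul_sub, sub_mul, h1, h2, h3]; abel

lemma aux_K (H G M Mi D Di : Matrix V V ℝ) (hM : M = H - D) (hGH : G * H = 1)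
    (hMM : M * Mi = 1) (hD : Di * D = 1) :
    (Di - G) * (D + D * Mi * D) = 1 := by
  have hDe : D = H - M := by rw [hM]; abel
  have h1 : G * D * Mi = Mi - G := by
    have : G * (H - M) * Mi = (G * H) * Mi - G * (M * Mi) := by noncomm_ring
    rw [hDe, this, hGH, hMM]; simp
  have : (Di - G) * (D + D * Mi * D)
      = Di * D - G * D + (Di * D) * Mi * D - (G * D * Mi) * D := by noncomm_ring
  rw [this, hD, h1]; noncomm_ring

lemma aux_M (H G M D Di K Ki : Matrix V V ℝ) (hM : M = H - D) (hGH : G * H = 1)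
    (hHG : H * G = 1) (hK : K = Di - G)
    (hKK : K * Ki = 1) (hD : D * Di = 1) :
    M * (G + G * Ki * G) = 1 := by
  have hGe : G = Di - K := by rw [hK]; abel
  have h1 : D * G * Ki = Ki - D := by
    have : D * (Di - K) * Ki = (D * Di) * Ki - D * (K * Ki) := by noncomm_ring
    rw [hGe, this, hD, hKK]; simp
  have : M * (G + G * Ki * G)
      = H * G - D * G + (H * G) * Ki * G - (D * G * Ki) * G := by rw [hM]; noncomm_ring
  rw [this, hHG, h1]; noncomm_ring

lemma isUnit_diag (b : V → ℝ) (hb : ∀ i, 0 < b i) : IsUnit (diagonal b) := by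
  rw [Matrix.isUnit_iff_isUnit_det, det_diagonal, isUnit_iff_ne_zero]
  exact Finset.prod_ne_zero_iff.2 fun i _ => (hb i).ne'

lemma posDef_diag_conj (b : V → ℝ) (hb : ∀ i, 0 < b i) (X : Matrix V V ℝ) :
    (diagonal b * X * diagonal b).PosDef ↔ X.PosDef := by
  have := Matrix.IsUnit.posDef_star_left_conjugate_iff (x := X) (isUnit_diag b hb)
  rw [← this]
  simp [star_eq_conjTranspose, diagonal_conjTranspose]

lemma diag_inv_mul (a : V → ℝ) (ha : ∀ i, 0 < a i) :
    diagonal (fun i => (a i)⁻¹) * diagonal a = 1 := by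
  rw [diagonal_mul_diagonal, ← diagonal_one]
  congr 1; ext i; exact inv_mul_cancel₀ (ha i).ne'

lemma diag_mul_inv (a : V → ℝ) (ha : ∀ i, 0 < a i) :
    diagonal a * diagonal (fun i => (a i)⁻¹) = 1 := by
  rw [diagonal_mul_diagonal, ← diagonal_one]
  congr 1; ext i; exact mul_inv_cancel₀ (ha i).ne'

lemma core_pos (W : Matrix V V ℝ) (a b : V → ℝ) (ha : ∀ i, 0 < a i) (hb : ∀ i, 0 < b i) :
    (diagonal b - W - diagonal a).PosDef ↔ (diagonal b - W).PosDef ∧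
      (diagonal (fun i => b i ^ 2 / a i - b i)
        - (W + W * (diagonal b - W)⁻¹ * W)).PosDef := by
  have hDp : (diagonal a).PosDef := PosDef.diagonal ha
  constructor
  · intro hM
    have hH : (diagonal b - W).PosDef := by
      have := hM.add hDp
      simpa using this
    refine ⟨hH, ?_⟩
    have hu := (Matrix.isUnit_iff_isUnit_det _).1 hH.isUnit
    have huM := (Matrix.isUnit_iff_isUnit_det _).1 hM.isUnit
    rw [aux_HT W _ _ _ a b rfl rfl (nonsing_inv_mul _ hu) (mul_nonsing_inv _ hu),
      posDef_diag_conj b hb]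
    have hK := aux_K _ _ _ _ _ _ rfl (nonsing_inv_mul _ hu) (mul_nonsing_inv _ huM)
      (diag_inv_mul a ha)
    rw [← Matrix.inv_eq_left_inv hK]
    exact (hDp.add ((posDef_diag_conj a ha _).2 hM.inv)).inv
  · rintro ⟨hH, hT⟩
    have hu := (Matrix.isUnit_iff_isUnit_det _).1 hH.isUnit
    rw [aux_HT W _ _ _ a b rfl rfl (nonsing_inv_mul _ hu) (mul_nonsing_inv _ hu),
      posDef_diag_conj b hb] at hT
    have huK := (Matrix.isUnit_iff_isUnit_det _).1 hT.isUnit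
    have hM := aux_M _ _ _ _ _ _ _ rfl (nonsing_inv_mul _ hu) (mul_nonsing_inv _ hu)
      rfl (mul_nonsing_inv _ huK) (diag_mul_inv a ha)
    rw [← Matrix.inv_eq_left_inv hM]
    have h2 : ((diagonal b - W)⁻¹ * (diagonal (fun i => (a i)⁻¹) - (diagonal b - W)⁻¹)⁻¹ *
        (diagonal b - W)⁻¹).PosDef := by
      have := (Matrix.IsUnit.posDef_star_left_conjugate_iff 
        (x := (diagonal (fun i => (a i)⁻¹) - (diagonal b - W)⁻¹)⁻¹) hH.inv.isUnit).2 hT.inv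
      rwa [star_eq_conjTranspose, hH.inv.isHermitian.eq] at this
    exact (hH.inv.add h2).inv

lemma core_det (W : Matrix V V ℝ) (a b : V → ℝ) (ha : ∀ i, 0 < a i)
    (hH : (diagonal b - W).PosDef) :
    (diagonal b - W).det * (diagonal (fun i => b i ^ 2 / a i - b i)
        - (W + W * (diagonal b - W)⁻¹ * W)).det =
      (∏ i, b i ^ 2 / a i) * (diagonal b - W - diagonal a).det := by
  have hu := (Matrix.isUnit_iff_isUnit_det _).1 hH.isUnit
  rw [aux_HT W _ _ _ a b rfl rfl (nonsing_inv_mul _ hu) (mul_nonsing_inv _ hu)]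
  have h1 : diagonal a * (diagonal (fun i => (a i)⁻¹) - (diagonal b - W)⁻¹) * (diagonal b - W)
      = diagonal b - W - diagonal a := by
    rw [mul_sub (diagonal a) (diagonal fun i => (a i)⁻¹), diag_mul_inv a ha,
      sub_mul 1, Matrix.one_mul, Matrix.mul_assoc,
      nonsing_inv_mul _ hu, Matrix.mul_one]
  rw [← h1, det_mul, det_mul, det_mul, det_mul, det_diagonal, det_diagonal,
    Finset.prod_div_distrib, Finset.prod_pow]
  have : (∏ i, a i) ≠ 0 := Finset.prod_ne_zero_iff.2 fun i _ => (ha i).ne'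
  field_simp

lemma core_quad (W : Matrix V V ℝ) (a b : V → ℝ) (ha : ∀ i, 0 < a i)
    (hb : ∀ i, 0 < b i)
    (hH : (diagonal b - W).PosDef) (hM : (diagonal b - W - diagonal a).PosDef)
    (η x : V → ℝ) :
    (η ⬝ᵥ (diagonal b - W - diagonal a)⁻¹ *ᵥ η =
      η ⬝ᵥ (diagonal b - W)⁻¹ *ᵥ η +
      (fun i => η i + (W *ᵥ ((diagonal b - W)⁻¹ *ᵥ η)) i) ⬝ᵥ
      (diagonal (fun i => b i ^ 2 / a i - b i) - (W + W * (diagonal b - W)⁻¹ * W))⁻¹ *ᵥ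
      (fun i => η i + (W *ᵥ ((diagonal b - W)⁻¹ *ᵥ η)) i)) ∧
    ((fun i => x i / b i) ⬝ᵥ
      (diagonal (fun i => b i ^ 2 / a i - b i) - (W + W * (diagonal b - W)⁻¹ * W)) *ᵥ
      (fun i => x i / b i) = (∑ i, x i ^ 2 / a i) - x ⬝ᵥ (diagonal b - W)⁻¹ *ᵥ x) ∧
    ((fun i => η i + (W *ᵥ ((diagonal b - W)⁻¹ *ᵥ η)) i) ⬝ᵥ (fun i => x i / b i) =
      η ⬝ᵥ (diagonal b - W)⁻¹ *ᵥ x) ∧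
    x ⬝ᵥ (diagonal b - W)⁻¹ *ᵥ η = η ⬝ᵥ (diagonal b - W)⁻¹ *ᵥ x := by
  have hT := ((core_pos W a b ha hb).1 hM).2
  have hu := (Matrix.isUnit_iff_isUnit_det _).1 hH.isUnit
  rw [aux_HT W _ _ _ a b rfl rfl (nonsing_inv_mul _ hu) (mul_nonsing_inv _ hu)] at hT ⊢
  have hK := (posDef_diag_conj b hb _).1 hT
  have huK := (Matrix.isUnit_iff_isUnit_det _).1 hK.isUnit
  have hMe := aux_M _ _ _ _ _ _ _ rfl (nonsing_inv_mul _ hu) (mul_nonsing_inv _ hu)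
      rfl (mul_nonsing_inv _ huK) (diag_mul_inv a ha)
  rw [Matrix.inv_eq_right_inv hMe]
  have hGs : (diagonal b - W)⁻¹ᵀ = (diagonal b - W)⁻¹ := by
    simpa [IsHermitian] using hH.inv.isHermitian
  have hη : (fun i => η i + (W *ᵥ ((diagonal b - W)⁻¹ *ᵥ η)) i)
      = diagonal b *ᵥ ((diagonal b - W)⁻¹ *ᵥ η) := by
    have : diagonal b = (diagonal b - W) + W := by abel
    conv_rhs => rw [this, add_mulVec, mulVec_mulVec, ← this, mul_nonsing_inv _ hu, one_mulVec]
    rfl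
  have hx : diagonal b *ᵥ (fun i => x i / b i) = x := by
    ext i; rw [mulVec_diagonal]; exact mul_div_cancel₀ _ (hb i).ne'
  have hinv : (diagonal b * (diagonal (fun i => (a i)⁻¹) - (diagonal b - W)⁻¹) * diagonal b)⁻¹
     = diagonal (fun i => (b i)⁻¹) * (diagonal (fun i => (a i)⁻¹) - (diagonal b - W)⁻¹)⁻¹ *
       diagonal (fun i => (b i)⁻¹) := by
    rw [Matrix.mul_inv_rev, Matrix.mul_inv_rev, Matrix.inv_eq_right_inv (diag_mul_inv b hb),
      Matrix.mul_assoc]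
  generalize hG : (diagonal b - W)⁻¹ = G at *
  have hsym : ∀ (u v : V → ℝ), (G *ᵥ u) ⬝ᵥ v = u ⬝ᵥ (G *ᵥ v) := by
    intro u v
    rw [dotProduct_mulVec, ← mulVec_transpose, hGs]
  have hd : ∀ (c u v : V → ℝ), (diagonal c *ᵥ u) ⬝ᵥ v = u ⬝ᵥ (diagonal c *ᵥ v) := by
    intro c u v
    rw [dotProduct_mulVec, ← mulVec_transpose, diagonal_transpose]
  have hbb : ∀ u, diagonal (fun i => (b i)⁻¹) *ᵥ (diagonal b *ᵥ u) = u := by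
    intro u; rw [mulVec_mulVec, diag_inv_mul b hb, one_mulVec]
  have hbb' : ∀ u, diagonal b *ᵥ (diagonal (fun i => (b i)⁻¹) *ᵥ u) = u := by
    intro u; rw [mulVec_mulVec, diag_mul_inv b hb, one_mulVec]
  refine ⟨?_, ?_, ?_, ?_⟩
  · rw [hη, hinv, ← mulVec_mulVec, ← mulVec_mulVec, hbb, hd, hbb', hsym, add_mulVec,
      dotProduct_add, ← mulVec_mulVec, ← mulVec_mulVec]
  · rw [← mulVec_mulVec, ← mulVec_mulVec, hx, ← hd, hx, sub_mulVec, dotProduct_sub]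
    congr 1
    simp only [dotProduct, mulVec_diagonal]
    exact Finset.sum_congr rfl fun i _ => by ring
  · rw [hη, hd, hx, hsym]
  · rw [← hsym, dotProduct_comm]

end matrixpart

section densitypart
variable [Fintype V] [DecidableEq V]

noncomputable def gIG (z θ t : ℝ) : ℝ :=
  if 0 < t then
    1 / (z * Real.sqrt (2 * Real.pi * t ^ 3)) *
      Real.exp (-(θ * t - 1 / z) ^ 2 / (2 * t))
  else 0

lemma nd_pos {W : Matrix V V ℝ} {θ η β : V → ℝ} (h : (Hmat W β).PosDef) :
    nuDensity W θ η β = (2 / Real.pi) ^ ((Fintype.card V : ℝ) / 2) *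
        Real.exp (-(1 / 2) * (θ ⬝ᵥ Hmat W β *ᵥ θ)
          - (1 / 2) * (η ⬝ᵥ (Hmat W β)⁻¹ *ᵥ η) + η ⬝ᵥ θ) *
        (∏ i, θ i) / Real.sqrt (Hmat W β).det :=
  Set.indicator_of_mem (s := {β : V → ℝ | (Hmat W β).PosDef}) h _

lemma nd_neg {W : Matrix V V ℝ} {θ η β : V → ℝ} (h : ¬ (Hmat W β).PosDef) :
    nuDensity W θ η β = 0 :=
  Set.indicator_of_notMem (s := {β : V → ℝ | (Hmat W β).PosDef}) h _

lemma scalar_id (a b z : ℝ) (ha : 0 < a) (hb : 0 < b) (hz : 0 < z) :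
    Real.sqrt (2 / Real.pi) * (1 / (b * z)) / (b / Real.sqrt a) =
      2 * a ^ 2 / b ^ 2 * (1 / (z * Real.sqrt (2 * Real.pi * a ^ 3))) := by
  have hpi := Real.pi_pos
  have h1 : Real.sqrt (2 * Real.pi * a ^ 3) = Real.sqrt 2 * Real.sqrt Real.pi * (a * Real.sqrt a) := by
    rw [Real.sqrt_mul (by positivity), Real.sqrt_mul (by positivity)]
    congr 1
    rw [show a ^ 3 = a ^ 2 * a by ring, Real.sqrt_mul (by positivity), Real.sqrt_sq ha.le]
  have h2 : Real.sqrt (2 / Real.pi) = Real.sqrt 2 / Real.sqrt Real.pi :=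
    Real.sqrt_div (by norm_num) _
  rw [h1, h2]
  have e1 : Real.sqrt 2 ^ 2 = 2 := Real.sq_sqrt (by norm_num)
  have e2 : Real.sqrt a ^ 2 = a := Real.sq_sqrt ha.le
  have p1 : 0 < Real.sqrt 2 := by positivity
  have p2 : 0 < Real.sqrt Real.pi := by positivity
  have p3 : 0 < Real.sqrt a := by positivity
  field_simp
  rw [e1, e2]

lemma dens_id (W : Matrix V V ℝ) (θ η z β α a : V → ℝ)
    (hz : ∀ i, 0 < z i) (hβ : ∀ i, 0 < β i) (ha : ∀ i, 0 < a i)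
    (hα : ∀ i, 2 * α i = (2 * β i) ^ 2 / a i - 2 * β i) :
    nuDensity W θ (fun i => η i + 1 / z i) β *
      nuDensity (W + W * (Hmat W β)⁻¹ * W) (fun i => 1 / (2 * β i * z i))
          (fun i => η i + (W *ᵥ ((Hmat W β)⁻¹ *ᵥ η)) i) α =
    (∏ i, (2 * a i ^ 2 / (2 * β i) ^ 2)) *
      (nuDensity W θ η (fun i => β i - a i / 2) * ∏ i, gIG (z i) (θ i) (a i)) := by
  obtain ⟨b, hbdef⟩ : ∃ b : V → ℝ, b = fun i => 2 * β i := ⟨_, rfl⟩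
  have hbi : ∀ i, 2 * β i = b i := fun i => by rw [hbdef]
  have hb : ∀ i, 0 < b i := fun i => by rw [hbdef]; have := hβ i; simp [this]
  have e1 : Hmat W β = diagonal b - W := by rw [Hmat, hbdef]
  have e2 : Hmat W (fun i => β i - a i / 2) = diagonal b - W - diagonal a := by
    rw [Hmat, hbdef, sub_right_comm, diagonal_sub]
    congr 2; ext i; ring
  have e3 : ∀ W', Hmat W' α = diagonal (fun i => b i ^ 2 / a i - b i) - W' := by
    intro W'; rw [Hmat]; congr 2; ext i; rw [hα, hbi]
  by_cases hM : (diagonal b - W - diagonal a).PosDef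
  swap
  · rw [nd_neg (β := fun i => β i - a i / 2) (by rwa [e2])]
    rw [core_pos W a b ha hb, not_and_or] at hM
    rcases hM with h | h
    · rw [nd_neg (β := β) (by rwa [e1])]; simp
    · rw [nd_neg (β := α) (by rwa [e3, e1])]; simp
  obtain ⟨hH, hT⟩ := (core_pos W a b ha hb).1 hM
  rw [nd_pos (β := fun i => β i - a i / 2) (by rwa [e2]), nd_pos (β := β) (by rwa [e1]),
    nd_pos (β := α) (by rwa [e3, e1])]
  simp only [e1, e2, e3, hbi]
  have hdet := core_det W a b ha hH
  obtain ⟨q1, q2, q3, q4⟩ := core_quad W a b ha hb hH hM η (fun i => 1 / z i)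
  have hsq : Real.sqrt (diagonal b - W).det * Real.sqrt (diagonal (fun i => b i ^ 2 / a i - b i)
        - (W + W * (diagonal b - W)⁻¹ * W)).det =
      (∏ i, b i / Real.sqrt (a i)) * Real.sqrt (diagonal b - W - diagonal a).det := by
    rw [← Real.sqrt_mul hH.det_pos.le, hdet, Real.sqrt_mul
      (Finset.prod_nonneg fun i _ => div_nonneg (sq_nonneg _) (ha i).le)]
    congr 1
    rw [Real.sqrt_eq_iff_mul_self_eq
      (Finset.prod_nonneg fun i _ => div_nonneg (sq_nonneg _) (ha i).le)
      (Finset.prod_nonneg fun i _ => div_nonneg (hb i).le (Real.sqrt_nonneg _)),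
      ← Finset.prod_mul_distrib]
    refine Finset.prod_congr rfl fun i _ => ?_
    rw [div_mul_div_comm, Real.mul_self_sqrt (ha i).le, sq]
  have hc : (2 / Real.pi) ^ ((Fintype.card V : ℝ) / 2) = ∏ _i : V, Real.sqrt (2 / Real.pi) := by
    rw [Finset.prod_const, Finset.card_univ, Real.sqrt_eq_rpow, ← Real.rpow_natCast,
      ← Real.rpow_mul (by positivity)]
    congr 1; ring
  have hg : ∏ i, gIG (z i) (θ i) (a i) = (∏ i, 1 / (z i * Real.sqrt (2 * Real.pi * a i ^ 3))) *
      Real.exp (∑ i, -(θ i * a i - 1 / z i) ^ 2 / (2 * a i)) := by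
    rw [Real.exp_sum, ← Finset.prod_mul_distrib]
    exact Finset.prod_congr rfl fun i _ => by rw [gIG, if_pos (ha i)]
  have hprod : (∏ _i : V, Real.sqrt (2 / Real.pi)) * (∏ i, 1 / (b i * z i)) /
      (∏ i, b i / Real.sqrt (a i)) =
      (∏ i, (2 * a i ^ 2 / b i ^ 2)) * ∏ i, 1 / (z i * Real.sqrt (2 * Real.pi * a i ^ 3)) := by
    rw [← Finset.prod_mul_distrib, ← Finset.prod_div_distrib, ← Finset.prod_mul_distrib]
    exact Finset.prod_congr rfl fun i _ => scalar_id _ _ _ (ha i) (hb i) (hz i)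
  have hθθ : (fun i => 1 / (b i * z i)) = (fun i => (1 / z i) / b i) := by
    ext i; rw [div_div, mul_comm]
  have hexp : (-(1 / 2) * (θ ⬝ᵥ (diagonal b - W) *ᵥ θ) -
        (1 / 2) * ((fun i => η i + 1 / z i) ⬝ᵥ (diagonal b - W)⁻¹ *ᵥ (fun i => η i + 1 / z i)) +
        (fun i => η i + 1 / z i) ⬝ᵥ θ) +
      (-(1 / 2) * ((fun i => 1 / (b i * z i)) ⬝ᵥ
        (diagonal (fun i => b i ^ 2 / a i - b i) - (W + W * (diagonal b - W)⁻¹ * W)) *ᵥ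
          (fun i => 1 / (b i * z i))) -
       (1 / 2) * ((fun i => η i + (W *ᵥ ((diagonal b - W)⁻¹ *ᵥ η)) i) ⬝ᵥ
      (diagonal (fun i => b i ^ 2 / a i - b i) - (W + W * (diagonal b - W)⁻¹ * W))⁻¹ *ᵥ
      (fun i => η i + (W *ᵥ ((diagonal b - W)⁻¹ *ᵥ η)) i)) +
      (fun i => η i + (W *ᵥ ((diagonal b - W)⁻¹ *ᵥ η)) i) ⬝ᵥ (fun i => 1 / (b i * z i))) =
      (-(1 / 2) * (θ ⬝ᵥ (diagonal b - W - diagonal a) *ᵥ θ) -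
        (1 / 2) * (η ⬝ᵥ (diagonal b - W - diagonal a)⁻¹ *ᵥ η) + η ⬝ᵥ θ) +
      ∑ i, -(θ i * a i - 1 / z i) ^ 2 / (2 * a i) := by
    have hadd : (fun i => η i + 1 / z i) = η + fun i => 1 / z i := rfl
    rw [hθθ, q2, q3, q1, hadd, mulVec_add, dotProduct_add, add_dotProduct, add_dotProduct, q4,
      add_dotProduct, sub_mulVec _ (diagonal a), dotProduct_sub]
    have hs : ∑ i, -(θ i * a i - 1 / z i) ^ 2 / (2 * a i) =
        -(1 / 2) * (θ ⬝ᵥ diagonal a *ᵥ θ) + (fun i => 1 / z i) ⬝ᵥ θ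
          - (1 / 2) * ∑ i, (1 / z i) ^ 2 / a i := by
      simp only [dotProduct, mulVec_diagonal, Finset.mul_sum]
      rw [← Finset.sum_add_distrib, ← Finset.sum_sub_distrib]
      refine Finset.sum_congr rfl fun i _ => ?_
      have := (ha i).ne'
      have := (hz i).ne'
      field_simp
      ring
    rw [hs]; ring
  rw [hc, hg, div_mul_div_comm, hsq]
  generalize (∏ i, b i / Real.sqrt (a i)) = X1 at *
  generalize (∏ _i : V, Real.sqrt (2 / Real.pi)) = X2 at *
  generalize (∏ i, 1 / (b i * z i)) = X3 at *
  generalize (∏ i, (2 * a i ^ 2 / b i ^ 2)) = X4 at *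
  generalize (∏ i, 1 / (z i * Real.sqrt (2 * Real.pi * a i ^ 3))) = X5 at *
  generalize (Real.sqrt (diagonal b - W - diagonal a).det) = X6 at *
  have hexp' := congrArg Real.exp hexp
  rw [Real.exp_add, Real.exp_add _ (∑ i, -(θ i * a i - 1 / z i) ^ 2 / (2 * a i))] at hexp'
  calc _ = X2 * (∏ i, θ i) / X6 * (X2 * X3 / X1) * (_ * _) := by
        rw [← hexp']; ring
    _ = _ := by rw [hprod]; ring

end densitypart

section measpart

lemma lintegral_prod_fin {n : ℕ} (f : Fin n → ℝ → ENNReal) (hf : ∀ i, Measurable (f i)) :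
    ∫⁻ x : Fin n → ℝ, ∏ i, f i (x i) = ∏ i, ∫⁻ x, f i x := by
  induction n with
  | zero => simp [volume_pi]
  | succ n ih =>
    rw [← ((volume_preserving_piFinSuccAbove (fun _ : Fin (n+1) => ℝ) 0).symm).lintegral_comp_emb
      (MeasurableEquiv.measurableEmbedding _)]
    simp_rw [MeasurableEquiv.piFinSuccAbove_symm_apply, Fin.insertNthEquiv,
            Fin.prod_univ_succ, Fin.insertNth_zero, Equiv.coe_fn_mk, Fin.cons_succ,
            Fin.cons_zero]
    rw [← ih _ (fun i => hf i.succ)]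
    rw [← lintegral_prod_mul (hf 0).aemeasurable
      (Finset.measurable_prod _ fun i _ => (hf i.succ).comp (measurable_pi_apply i)).aemeasurable]
    rfl

lemma lintegral_prod_fintype [Fintype V] (f : V → ℝ → ENNReal) (hf : ∀ i, Measurable (f i)) :
    ∫⁻ x : V → ℝ, ∏ i, f i (x i) = ∏ i, ∫⁻ x, f i x := by
  let e := (Fintype.equivFin V).symm
  rw [← (volume_measurePreserving_piCongrLeft (fun _ : V => ℝ) e).lintegral_comp_emb
    (MeasurableEquiv.measurableEmbedding _)]
  simp_rw [← e.prod_comp, MeasurableEquiv.coe_piCongrLeft, Equiv.piCongrLeft_apply_apply]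
  exact lintegral_prod_fin _ fun i => hf _

lemma pi_withDensity_ofReal [Fintype V] (f : V → ℝ → ℝ) (hf : ∀ i, Measurable (f i)) :
    Measure.pi (fun i => (volume : Measure ℝ).withDensity fun t => ENNReal.ofReal (f i t)) =
    (volume : Measure (V → ℝ)).withDensity fun x => ∏ i, ENNReal.ofReal (f i (x i)) := by
  refine Measure.pi_eq fun s hs => ?_
  rw [withDensity_apply _ (MeasurableSet.univ_pi hs),
    ← lintegral_indicator (MeasurableSet.univ_pi hs)]
  have : ((Set.univ.pi s).indicator fun x : V → ℝ => ∏ i, ENNReal.ofReal (f i (x i))) =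
      fun x => ∏ i, (s i).indicator (fun t => ENNReal.ofReal (f i t)) (x i) := by
    ext x
    by_cases hx : x ∈ Set.univ.pi s
    · rw [Set.indicator_of_mem hx]
      exact Finset.prod_congr rfl fun i _ => by
        rw [Set.indicator_of_mem (hx i (Set.mem_univ i))]
    · rw [Set.indicator_of_notMem hx]
      simp only [Set.mem_pi, Set.mem_univ, true_imp_iff, not_forall] at hx
      obtain ⟨i, hi⟩ := hx
      exact (Finset.prod_eq_zero (Finset.mem_univ i) (Set.indicator_of_notMem hi _)).symm
  rw [this, lintegral_prod_fintype _ fun i => ((hf i).ennreal_ofReal).indicator (hs i)]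
  refine Finset.prod_congr rfl fun i _ => ?_
  rw [lintegral_indicator (hs i), withDensity_apply _ (hs i)]

variable [Fintype V] [DecidableEq V]

lemma measurableSet_posDef : MeasurableSet {m : V → V → ℝ | (Matrix.of m).PosDef} := by
  have : {m : V → V → ℝ | (Matrix.of m).PosDef} =
      ({m | (Matrix.of m)ᴴ = Matrix.of m} ∩
        ⋂ x : V → ℝ, {m | 0 ≤ x ⬝ᵥ (Matrix.of m *ᵥ x)}) ∩ {m | (Matrix.of m).det ≠ 0} := by
    ext m
    simp only [Set.mem_ofPred_eq, Set.mem_inter_iff, Set.mem_iInter]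
    constructor
    · intro h
      exact ⟨⟨h.isHermitian, fun x => by
        simpa using h.posSemidef.dotProduct_mulVec_nonneg x⟩, h.det_pos.ne'⟩
    · rintro ⟨⟨h1, h2⟩, h3⟩
      have : (Matrix.of m).PosSemidef := .of_dotProduct_mulVec_nonneg h1 fun x => by
        simpa using h2 x
      exact this.posDef_iff_det_ne_zero.2 h3
  rw [this]
  have hc : Continuous fun m : V → V → ℝ => Matrix.of m := continuous_id
  refine (IsClosed.measurableSet ?_).inter (IsOpen.measurableSet ?_)
  · refine (isClosed_eq hc.matrix_conjTranspose hc).inter (isClosed_iInter fun x => ?_)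
    exact isClosed_le continuous_const (continuous_const.dotProduct (hc.matrix_mulVec continuous_const))
  · exact isOpen_ne_fun hc.matrix_det continuous_const

variable {X : Type*} [MeasurableSpace X]

lemma meas_det (f : X → Matrix V V ℝ) (hf : ∀ i j, Measurable fun x => f x i j) :
    Measurable fun x => (f x).det := by
  have h : Measurable (fun x => (fun i j => f x i j : V → V → ℝ)) :=
    measurable_pi_lambda _ fun i => measurable_pi_lambda _ fun j => hf i j
  have hc : Continuous fun m : V → V → ℝ => (Matrix.of m).det :=
    (continuous_id : Continuous fun m : V → V → ℝ => Matrix.of m).matrix_det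
  exact hc.measurable.comp h

lemma meas_inv (f : X → Matrix V V ℝ) (hf : ∀ i j, Measurable fun x => f x i j) (i j : V) :
    Measurable fun x => (f x)⁻¹ i j := by
  have h : Measurable (fun x => (fun i j => f x i j : V → V → ℝ)) :=
    measurable_pi_lambda _ fun i => measurable_pi_lambda _ fun j => hf i j
  have hc : Continuous fun m : V → V → ℝ => (Matrix.of m).adjugate i j :=
    (continuous_id : Continuous fun m : V → V → ℝ => Matrix.of m).matrix_adjugate.matrix_elem i j
  have h2 : Measurable fun x => (f x).adjugate i j := hc.measurable.comp h
  simp only [Matrix.inv_def, Ring.inverse_eq_inv', Matrix.smul_apply, smul_eq_mul]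
  exact (meas_det f hf).inv.mul h2

lemma meas_mulVec (f : X → Matrix V V ℝ) (hf : ∀ i j, Measurable fun x => f x i j)
    (g : X → V → ℝ) (hg : ∀ i, Measurable fun x => g x i) (i : V) :
    Measurable fun x => (f x *ᵥ g x) i := by
  simp only [mulVec, dotProduct]
  exact Finset.measurable_sum _ fun j _ => (hf i j).mul (hg j)

lemma meas_mul (f g : X → Matrix V V ℝ) (hf : ∀ i j, Measurable fun x => f x i j)
    (hg : ∀ i j, Measurable fun x => g x i j) (i j : V) :
    Measurable fun x => (f x * g x) i j := by
  simp only [Matrix.mul_apply]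
  exact Finset.measurable_sum _ fun k _ => (hf i k).mul (hg k j)

lemma meas_dot (f g : X → V → ℝ) (hf : ∀ i, Measurable fun x => f x i)
    (hg : ∀ i, Measurable fun x => g x i) :
    Measurable fun x => f x ⬝ᵥ g x := by
  simp only [dotProduct]
  exact Finset.measurable_sum _ fun k _ => (hf k).mul (hg k)

lemma meas_Hmat (W : X → Matrix V V ℝ) (β : X → V → ℝ) 
    (hW : ∀ i j, Measurable fun x => W x i j)
    (hβ : ∀ i, Measurable fun x => β x i) (i j : V) :
    Measurable fun x => Hmat (W x) (β x) i j := by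
  simp only [Hmat, Matrix.sub_apply, Matrix.diagonal_apply]
  refine Measurable.sub ?_ (hW i j)
  split_ifs
  · exact (hβ i).const_mul 2
  · exact measurable_const

lemma meas_nuDensity (W : X → Matrix V V ℝ) (θ η β : X → V → ℝ)
    (hW : ∀ i j, Measurable fun x => W x i j)
    (hθ : ∀ i, Measurable fun x => θ x i) (hη : ∀ i, Measurable fun x => η x i)
    (hβ : ∀ i, Measurable fun x => β x i) :
    Measurable fun x => nuDensity (W x) (θ x) (η x) (β x) := by
  have hH := meas_Hmat W β hW hβ
  simp only [nuDensity, Set.indicator, Set.mem_ofPred_eq]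
  refine Measurable.ite ?_ ?_ measurable_const
  · have h : Measurable (fun x => (fun i j => Hmat (W x) (β x) i j : V → V → ℝ)) :=
      measurable_pi_lambda _ fun i => measurable_pi_lambda _ fun j => hH i j
    exact h measurableSet_posDef
  · refine Measurable.div (Measurable.mul (Measurable.const_mul (Measurable.exp ?_) _) ?_) ?_
    · refine Measurable.add (Measurable.sub (Measurable.const_mul ?_ _)
        (Measurable.const_mul ?_ _)) (meas_dot _ _ hη hθ)
      · exact meas_dot _ _ hθ (meas_mulVec _ hH _ hθ)
      · exact meas_dot _ _ hη (meas_mulVec _ (meas_inv _ hH) _ hη)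
    · exact Finset.measurable_prod _ fun i _ => hθ i
    · exact (meas_det _ hH).sqrt

lemma meas_gIG (z θ : ℝ) : Measurable (gIG z θ) := by
  unfold gIG
  refine Measurable.ite measurableSet_Ioi (by fun_prop) measurable_const

end measpart

section finalpart
variable [Fintype V] [DecidableEq V]

lemma pos_of_posDef {W : Matrix V V ℝ} {β : V → ℝ} (hW : ∀ i, 0 ≤ W i i)
    (h : (Hmat W β).PosDef) (i : V) : 0 < β i := by
  have := h.diag_pos (i := i)
  simp only [Hmat, Matrix.sub_apply, Matrix.diagonal_apply_eq] at this
  linarith [hW i]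

lemma nd_nonneg {W : Matrix V V ℝ} {θ η β : V → ℝ} (hθ : ∀ i, 0 < θ i) :
    0 ≤ nuDensity W θ η β := by
  by_cases h : (Hmat W β).PosDef
  · rw [nd_pos h]
    have : 0 ≤ ∏ i, θ i := Finset.prod_nonneg fun i _ => (hθ i).le
    have := Real.pi_pos
    positivity
  · rw [nd_neg h]

lemma gIG_nonneg {z θ t : ℝ} (hz : 0 < z) : 0 ≤ gIG z θ t := by
  unfold gIG
  split_ifs
  · positivity
  · exact le_rfl

lemma map_wd (d : (V → ℝ) → ℝ) (hd : Measurable d) (φ : (V → ℝ) → (V → ℝ) × (V → ℝ))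
    (hφ : Measurable φ) (T : Set ((V → ℝ) × (V → ℝ))) (hT : MeasurableSet T) :
    Measure.map φ (volume.withDensity fun x => ENNReal.ofReal (d x)) T =
      ∫⁻ x, ENNReal.ofReal (d x) * T.indicator 1 (φ x) := by
  rw [← lintegral_indicator_one hT, lintegral_map (measurable_one.indicator hT) hφ]
  exact lintegral_withDensity_eq_lintegral_mul _ hd.ennreal_ofReal
    ((measurable_one.indicator hT).comp hφ)

lemma map_nu (W : Matrix V V ℝ) (θ η : V → ℝ) (φ : (V → ℝ) → (V → ℝ) × (V → ℝ))
    (hφ : Measurable φ) (T : Set ((V → ℝ) × (V → ℝ))) (hT : MeasurableSet T) :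
    Measure.map φ (nu W θ η) T =
      ∫⁻ x, ENNReal.ofReal (nuDensity W θ η x) * T.indicator 1 (φ x) :=
  map_wd _ (meas_nuDensity (fun _ => W) (fun _ => θ) (fun _ => η) (fun x : V → ℝ => x)
    (fun i j => measurable_const) (fun i => measurable_const)
      (fun i => measurable_const) (fun i => measurable_pi_apply i)) φ hφ T hT

lemma meas_p2 (W : Matrix V V ℝ) (η z : V → ℝ) :
    Measurable fun p : (V → ℝ) × (V → ℝ) =>
      nuDensity (W + W * (Hmat W p.1)⁻¹ * W)
          (fun i => 1 / (2 * p.1 i * z i))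
          (fun i => η i + (W *ᵥ ((Hmat W p.1)⁻¹ *ᵥ η)) i) p.2 := by
  have hG : ∀ i j, Measurable fun p : (V → ℝ) × (V → ℝ) => (Hmat W p.1)⁻¹ i j :=
    meas_inv _ (meas_Hmat (fun _ => W) (fun p : (V → ℝ) × (V → ℝ) => p.1)
      (fun i j => measurable_const) (fun i => by fun_prop))
  refine meas_nuDensity _ _ _ _ ?_ ?_ ?_ ?_
  · intro i j
    simp only [Matrix.add_apply]
    have h1 := meas_mul (fun _ => W) (fun p : (V → ℝ) × (V → ℝ) => (Hmat W p.1)⁻¹)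
      (fun i j => measurable_const) hG
    have h2 := meas_mul (fun p : (V → ℝ) × (V → ℝ) => W * (Hmat W p.1)⁻¹) (fun _ => W) h1
      (fun i j => measurable_const) i j
    exact h2.const_add _
  · intro i; fun_prop
  · intro i
    have h1 := meas_mulVec (fun p : (V → ℝ) × (V → ℝ) => (Hmat W p.1)⁻¹) hG (fun _ => η)
      (fun i => measurable_const)
    have h2 := meas_mulVec (fun _ => W) (fun i j => measurable_const)
      (fun p : (V → ℝ) × (V → ℝ) => (Hmat W p.1)⁻¹ *ᵥ η) h1 i
    exact h2.const_add _
  · intro i; fun_prop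

lemma T_deriv (b : ℝ) (hb : 0 < b) (x : ℝ) (hx : 0 < x) :
    HasDerivAt (fun x : ℝ => b ^ 2 / (2 * x + b)) (-(2 * b ^ 2 / (2 * x + b) ^ 2)) x := by
  have h1 : HasDerivAt (fun x : ℝ => 2 * x + b) 2 x := by
    simpa using ((hasDerivAt_id x).const_mul 2).add_const b
  have h2 := (hasDerivAt_const x (b ^ 2)).fun_div h1 (by positivity)
  refine h2.congr_deriv ?_
  rw [zero_mul, zero_sub, neg_div, mul_comm]

lemma cov (b : V → ℝ) (hb : ∀ i, 0 < b i) (g : (V → ℝ) → ENNReal) :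
    ∫⁻ a in {a : V → ℝ | ∀ i, 0 < a i ∧ a i < b i}, g a =
    ∫⁻ α in {α : V → ℝ | ∀ i, 0 < α i},
      ENNReal.ofReal (∏ i, 2 * b i ^ 2 / (2 * α i + b i) ^ 2) *
        g (fun i => b i ^ 2 / (2 * α i + b i)) := by
  have hs : MeasurableSet {α : V → ℝ | ∀ i, 0 < α i} := by
    have : {α : V → ℝ | ∀ i, 0 < α i} = ⋂ i, {α | 0 < α i} := by ext; simp
    rw [this]
    exact MeasurableSet.iInter fun i => measurableSet_lt measurable_const (measurable_pi_apply i)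
  have himg : {a : V → ℝ | ∀ i, 0 < a i ∧ a i < b i} =
      (fun (α : V → ℝ) i => b i ^ 2 / (2 * α i + b i)) '' {α : V → ℝ | ∀ i, 0 < α i} := by
    ext a
    constructor
    · intro h
      refine ⟨fun i => (b i ^ 2 / a i - b i) / 2, fun i => ?_, ?_⟩
      · obtain ⟨h1, h2⟩ := h i
        have : b i < b i ^ 2 / a i := by
          rw [lt_div_iff₀ h1, sq]; exact mul_lt_mul_of_pos_left h2 (hb i)
        simp only
        linarith
      · ext i
        have h1 := (h i).1.ne'
        have h2 := (hb i).ne'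
        simp only
        rw [show 2 * ((b i ^ 2 / a i - b i) / 2) + b i = b i ^ 2 / a i by ring]
        field_simp
    · rintro ⟨α, hα, rfl⟩ i
      have h1 : 0 < α i := hα i
      have h2 := hb i
      refine ⟨by simp only; positivity, ?_⟩
      simp only
      rw [div_lt_iff₀ (by positivity)]
      nlinarith [mul_pos h1 h2]
  rw [himg, lintegral_image_eq_lintegral_abs_det_fderiv_mul volume hs
    (f' := fun α => ContinuousLinearMap.pi fun i =>
      (ContinuousLinearMap.toSpanSingleton ℝ (-(2 * b i ^ 2 / (2 * α i + b i) ^ 2))).comp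
        (ContinuousLinearMap.proj i))]
  · refine setLIntegral_congr_fun hs fun α hα => ?_
    simp only
    rw [ContinuousLinearMap.det_pi, Finset.abs_prod]
    congr 2
    refine Finset.prod_congr rfl fun i _ => ?_
    have h1 : 0 < α i := hα i
    have h2 := hb i
    have : (ContinuousLinearMap.toSpanSingleton ℝ (-(2 * b i ^ 2 / (2 * α i + b i) ^ 2))).det
      = -(2 * b i ^ 2 / (2 * α i + b i) ^ 2) := by
      simp [ContinuousLinearMap.det]
    rw [this, abs_neg, abs_of_nonneg (by positivity)]
  · intro α hα
    refine HasFDerivAt.hasFDerivWithinAt ?_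
    rw [hasFDerivAt_pi]
    intro i
    exact HasFDerivAt.comp (g := fun x : ℝ => b i ^ 2 / (2 * x + b i))
      (f := fun α : V → ℝ => α i) α (T_deriv (b i) (hb i) (α i) (hα i)).hasFDerivAt
      (ContinuousLinearMap.proj (R := ℝ) (φ := fun _ : V => ℝ) i).hasFDerivAt
  · intro α hα α' hα' h
    ext i
    have h1 : 0 < α i := hα i
    have h1' : 0 < α' i := hα' i
    have h2 := hb i
    have := congrFun h i
    simp only at this
    rw [div_eq_div_iff (by positivity) (by positivity)] at this
    have := mul_left_cancel₀ (by positivity) this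
    linarith

lemma key_inner (W : Matrix V V ℝ) (hWsymm : W.IsSymm) (hWpos : ∀ i j, 0 ≤ W i j)
    (θ η : V → ℝ) (hθ : ∀ i, 0 < θ i)
    (z : V → ℝ) (hz : ∀ i, 0 < z i) (β : V → ℝ) (F : (V → ℝ) × (V → ℝ) → ENNReal) :
    ∫⁻ α : V → ℝ, ENNReal.ofReal (nuDensity W θ (fun i => η i + 1 / z i) β) *
      (ENNReal.ofReal (nuDensity (W + W * (Hmat W β)⁻¹ * W)
          (fun i => 1 / (2 * β i * z i))
          (fun i => η i + (W *ᵥ ((Hmat W β)⁻¹ *ᵥ η)) i) α) *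
          F ((fun i => 2 * β i), (fun i => (2 * β i) ^ 2 / (2 * α i)))) =
    ∫⁻ a : V → ℝ, (ENNReal.ofReal (nuDensity W θ η (fun i => β i - a i / 2)) *
      ∏ i, ENNReal.ofReal (gIG (z i) (θ i) (a i))) *
      F ((fun i => 2 * (β i - a i / 2) + a i),
        (fun i => a i + a i ^ 2 / (2 * (β i - a i / 2)))) := by
  have hzero : ∀ a : V → ℝ, ¬ (∀ i, 0 < a i ∧ a i < 2 * β i) →
      ENNReal.ofReal (nuDensity W θ η (fun i => β i - a i / 2)) *
      ∏ i, ENNReal.ofReal (gIG (z i) (θ i) (a i)) = 0 := by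
    intro a ha
    by_contra hne
    apply ha
    intro i
    have h1 := left_ne_zero_of_mul hne
    have h2 := right_ne_zero_of_mul hne
    constructor
    · by_contra hi
      refine h2 (Finset.prod_eq_zero (Finset.mem_univ i) ?_)
      rw [gIG, if_neg hi, ENNReal.ofReal_zero]
    · have : (Hmat W (fun i => β i - a i / 2)).PosDef := by
        by_contra hn
        rw [nd_neg hn, ENNReal.ofReal_zero] at h1
        exact h1 rfl
      have := pos_of_posDef (fun i => hWpos i i) this i
      linarith
  by_cases hβ : ∀ i, 0 < β i
  swap
  · rw [nd_neg (β := β) (fun h => hβ (pos_of_posDef (fun i => hWpos i i) h))]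
    simp only [ENNReal.ofReal_zero, zero_mul, lintegral_zero]
    symm
    rw [← lintegral_zero (μ := (volume : Measure (V → ℝ)))]
    refine lintegral_congr fun a => ?_
    rw [hzero a fun h => hβ fun i => by linarith [(h i).1, (h i).2], zero_mul]
  have hb : ∀ i, 0 < 2 * β i := fun i => by linarith [hβ i]
  have hR : ∫⁻ a : V → ℝ, (ENNReal.ofReal (nuDensity W θ η (fun i => β i - a i / 2)) *
      ∏ i, ENNReal.ofReal (gIG (z i) (θ i) (a i))) *
      F ((fun i => 2 * (β i - a i / 2) + a i),
        (fun i => a i + a i ^ 2 / (2 * (β i - a i / 2)))) = 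
      ∫⁻ a in {a : V → ℝ | ∀ i, 0 < a i ∧ a i < 2 * β i},
      (ENNReal.ofReal (nuDensity W θ η (fun i => β i - a i / 2)) *
      ∏ i, ENNReal.ofReal (gIG (z i) (θ i) (a i))) *
      F ((fun i => 2 * (β i - a i / 2) + a i),
        (fun i => a i + a i ^ 2 / (2 * (β i - a i / 2)))) := by
    rw [setLIntegral_eq_of_support_subset]
    intro a ha
    by_contra hn
    exact ha (by simp only [hzero a hn, zero_mul])
  rw [hR, cov (fun i => 2 * β i) hb, ← setLIntegral_eq_of_support_subset
    (s := {α : V → ℝ | ∀ i, 0 < α i})]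
  swap
  · intro α hα
    by_contra hn
    apply hα
    simp only
    by_cases hH : (Hmat W β).PosDef
    · rw [nd_neg (β := α), ENNReal.ofReal_zero, zero_mul, mul_zero]
      intro h
      refine hn (pos_of_posDef (fun i => ?_) h)
      have h2 : (W * (Hmat W β)⁻¹ * W).PosSemidef := by
        have := hH.inv.posSemidef.conjTranspose_mul_mul_same W
        rwa [conjTranspose_eq_transpose_of_trivial, hWsymm.eq] at this
      have := h2.diag_nonneg (i := i)
      simp only [Matrix.add_apply]
      linarith [hWpos i i]
    · rw [nd_neg hH, ENNReal.ofReal_zero, zero_mul]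
  have hs : MeasurableSet {α : V → ℝ | ∀ i, 0 < α i} := by
    have : {α : V → ℝ | ∀ i, 0 < α i} = ⋂ i, {α | 0 < α i} := by ext; simp
    rw [this]
    exact MeasurableSet.iInter fun i => measurableSet_lt measurable_const (measurable_pi_apply i)
  refine setLIntegral_congr_fun hs fun α hα => ?_
  have hαi : ∀ i, 0 < α i := hα
  simp only
  have ha : ∀ i, 0 < (2 * β i) ^ 2 / (2 * α i + 2 * β i) := fun i => by
    have := hαi i; have := hβ i; positivity
  have hid := dens_id W θ η z β α (fun i => (2 * β i) ^ 2 / (2 * α i + 2 * β i)) hz hβ ha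
    (fun i => by
      have := hαi i; have := hβ i
      field_simp
      ring)
  rw [← mul_assoc, ← ENNReal.ofReal_mul (nd_nonneg hθ), hid, ENNReal.ofReal_mul,
    ENNReal.ofReal_mul (nd_nonneg hθ),
    ENNReal.ofReal_prod_of_nonneg (fun i _ => gIG_nonneg (hz i)), mul_assoc]
  · have hP : ∏ i, 2 * ((2 * β i) ^ 2 / (2 * α i + 2 * β i)) ^ 2 / (2 * β i) ^ 2 =
        ∏ i, 2 * (2 * β i) ^ 2 / (2 * α i + 2 * β i) ^ 2 := by
      refine Finset.prod_congr rfl fun i _ => ?_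
      have := hαi i; have := hβ i
      field_simp
    have hF1 : (fun i => 2 * (β i - (2 * β i) ^ 2 / (2 * α i + 2 * β i) / 2) +
        (2 * β i) ^ 2 / (2 * α i + 2 * β i)) = fun i => 2 * β i := by
      ext i; ring
    have hF2 : (fun i => (2 * β i) ^ 2 / (2 * α i + 2 * β i) +
        ((2 * β i) ^ 2 / (2 * α i + 2 * β i)) ^ 2 /
          (2 * (β i - (2 * β i) ^ 2 / (2 * α i + 2 * β i) / 2))) =
        fun i => (2 * β i) ^ 2 / (2 * α i) := by
      ext i
      have h1 := hαi i; have h2 := hβ i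
      have : 2 * (β i - (2 * β i) ^ 2 / (2 * α i + 2 * β i) / 2) =
        2 * β i * (2 * α i) / (2 * α i + 2 * β i) := by
        field_simp
        ring
      rw [this]
      field_simp
      try ring
    rw [hP, hF1, hF2]
  · refine Finset.prod_nonneg fun i _ => ?_
    have := hαi i; have := hβ i
    positivity

end finalpart

/-- The identity in law of Theorem `thm:equalities_in_law`: the law of
`((2β_i)_i, ((2β_i)²/(2α_i))_i)` where `β ∼ ν_V^{W,θ,η+1/z}` and, given `β`,
`α ∼ ν_V^{W̃,θ̃,η̃}`, coincides with the law of `((2δ_i + A_i)_i, (A_i + A_i²/(2δ_i))_i)`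
where `δ ∼ ν_V^{W,θ,η}` and independently `A_i ∼ IG(1/(θ_i z_i), 1/z_i²)` are
independent. -/
theorem equalities_in_law [Fintype V] [DecidableEq V] [Nonempty V]
    (W : Matrix V V ℝ) (hWsymm : W.IsSymm) (hWpos : ∀ i j, 0 ≤ W i j)
    (θ η : V → ℝ) (hθ : ∀ i, 0 < θ i) (hη : ∀ i, 0 ≤ η i)
    (z : V → ℝ) (hz : ∀ i, 0 < z i) :
    Measure.bind (nu W θ (fun i => η i + 1 / z i)) (fun β =>
      Measure.map (fun α : V → ℝ =>
          ((fun i => 2 * β i), (fun i => (2 * β i) ^ 2 / (2 * α i))))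
        (nu (W + W * (Hmat W β)⁻¹ * W)
          (fun i => 1 / (2 * β i * z i))
          (fun i => η i + (W *ᵥ ((Hmat W β)⁻¹ *ᵥ η)) i))) =
    Measure.map (fun p : (V → ℝ) × (V → ℝ) =>
        ((fun i => 2 * p.1 i + p.2 i), (fun i => p.2 i + (p.2 i) ^ 2 / (2 * p.1 i))))
      ((nu W θ η).prod
        (Measure.pi fun i => volume.withDensity (fun t : ℝ => ENNReal.ofReal
          (if 0 < t then
            1 / (z i * Real.sqrt (2 * Real.pi * t ^ 3)) *
              Real.exp (-(θ i * t - 1 / z i) ^ 2 / (2 * t))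
          else 0)))) := by
  refine Measure.ext fun S hS => ?_
  set F : (V → ℝ) × (V → ℝ) → ENNReal := S.indicator 1 with hFdef
  have hF : Measurable F := measurable_one.indicator hS
  have hm1 : Measurable fun β => nuDensity W θ (fun i => η i + 1 / z i) β :=
    meas_nuDensity _ _ _ _ (fun i j => measurable_const) (fun i => measurable_const)
      (fun i => measurable_const) (fun i => measurable_pi_apply i)
  have hmq : Measurable fun β => nuDensity W θ η β :=
    meas_nuDensity _ _ _ _ (fun i j => measurable_const) (fun i => measurable_const)
      (fun i => measurable_const) (fun i => measurable_pi_apply i)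
  have hm2 := meas_p2 W η z
  have hφ : Measurable fun p : (V → ℝ) × (V → ℝ) =>
      ((fun i => 2 * p.1 i, fun i => (2 * p.1 i) ^ 2 / (2 * p.2 i)) : (V → ℝ) × (V → ℝ)) :=
    Measurable.prodMk (by fun_prop) (measurable_pi_lambda _ fun i => by fun_prop)
  have hψ : Measurable fun p : (V → ℝ) × (V → ℝ) =>
      ((fun i => 2 * p.1 i + p.2 i, fun i => p.2 i + (p.2 i) ^ 2 / (2 * p.1 i)) :
        (V → ℝ) × (V → ℝ)) :=
    Measurable.prodMk (by fun_prop) (measurable_pi_lambda _ fun i => by fun_prop)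
  have hφβ : ∀ β : V → ℝ, Measurable fun α : V → ℝ =>
      ((fun i => 2 * β i, fun i => (2 * β i) ^ 2 / (2 * α i)) : (V → ℝ) × (V → ℝ)) := fun β =>
    hφ.comp (measurable_const.prodMk measurable_id)
  have hker : ∀ (β : V → ℝ) (T : Set ((V → ℝ) × (V → ℝ))), MeasurableSet T →
      Measure.map (fun α : V → ℝ =>
          ((fun i => 2 * β i), (fun i => (2 * β i) ^ 2 / (2 * α i))))
        (nu (W + W * (Hmat W β)⁻¹ * W)
          (fun i => 1 / (2 * β i * z i))
          (fun i => η i + (W *ᵥ ((Hmat W β)⁻¹ *ᵥ η)) i)) T =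
      ∫⁻ α : V → ℝ, ENNReal.ofReal (nuDensity (W + W * (Hmat W β)⁻¹ * W)
          (fun i => 1 / (2 * β i * z i))
          (fun i => η i + (W *ᵥ ((Hmat W β)⁻¹ *ᵥ η)) i) α) *
          T.indicator 1 ((fun i => 2 * β i), (fun i => (2 * β i) ^ 2 / (2 * α i))) := by
    intro β T hT
    exact map_nu _ _ _ _ (hφβ β) T hT
  have hjoint : ∀ T : Set ((V → ℝ) × (V → ℝ)), MeasurableSet T →
      Measurable fun p : (V → ℝ) × (V → ℝ) =>
        ENNReal.ofReal (nuDensity (W + W * (Hmat W p.1)⁻¹ * W)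
          (fun i => 1 / (2 * p.1 i * z i))
          (fun i => η i + (W *ᵥ ((Hmat W p.1)⁻¹ *ᵥ η)) i) p.2) *
          T.indicator (1 : (V → ℝ) × (V → ℝ) → ENNReal)
            ((fun i => 2 * p.1 i), (fun i => (2 * p.1 i) ^ 2 / (2 * p.2 i))) := fun T hT =>
    hm2.ennreal_ofReal.mul ((measurable_one.indicator hT).comp hφ)
  have hkm : Measurable fun β => Measure.map (fun α : V → ℝ =>
          ((fun i => 2 * β i), (fun i => (2 * β i) ^ 2 / (2 * α i))))
        (nu (W + W * (Hmat W β)⁻¹ * W)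
          (fun i => 1 / (2 * β i * z i))
          (fun i => η i + (W *ᵥ ((Hmat W β)⁻¹ *ᵥ η)) i)) := by
    refine Measure.measurable_of_measurable_coe _ fun T hT => ?_
    simp only [hker _ T hT]
    exact (hjoint T hT).lintegral_prod_right'
  rw [Measure.bind_apply hS hkm.aemeasurable]
  simp only [hker _ S hS]
  rw [nu, lintegral_withDensity_eq_lintegral_mul _ hm1.ennreal_ofReal
    (hjoint S hS).lintegral_prod_right']
  simp only [Pi.mul_apply]
  have hg : Measurable fun x : V → ℝ => ∏ i, ENNReal.ofReal (gIG (z i) (θ i) (x i)) :=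
    Finset.measurable_prod _ fun i _ =>
      ((meas_gIG (z i) (θ i)).comp (measurable_pi_apply i)).ennreal_ofReal
  have hpi := pi_withDensity_ofReal (fun i => gIG (z i) (θ i)) (fun i => meas_gIG _ _)
  simp only [gIG] at hpi
  rw [hpi, nu, prod_withDensity hmq.ennreal_ofReal (by simpa only [gIG] using hg)]
  change _ = Measure.map _ (((volume : Measure (V → ℝ)).prod (volume : Measure (V → ℝ))).withDensity
    fun p : (V → ℝ) × (V → ℝ) => ENNReal.ofReal (nuDensity W θ η p.1) *
      ∏ i, ENNReal.ofReal (gIG (z i) (θ i) (p.2 i))) S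
  have hd : Measurable fun p : (V → ℝ) × (V → ℝ) => ENNReal.ofReal (nuDensity W θ η p.1) *
      ∏ i, ENNReal.ofReal (gIG (z i) (θ i) (p.2 i)) :=
    (hmq.comp measurable_fst).ennreal_ofReal.mul (hg.comp measurable_snd)
  rw [← lintegral_indicator_one (μ := Measure.map _ _) hS,
    lintegral_map (measurable_one.indicator hS) hψ]
  refine Eq.trans ?_ (lintegral_withDensity_eq_lintegral_mul _ hd (hF.comp hψ)).symm
  have hJ : Measurable ((fun p : (V → ℝ) × (V → ℝ) => ENNReal.ofReal (nuDensity W θ η p.1) *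
      ∏ i, ENNReal.ofReal (gIG (z i) (θ i) (p.2 i))) * (F ∘ fun p : (V → ℝ) × (V → ℝ) =>
      ((fun i => 2 * p.1 i + p.2 i, fun i => p.2 i + (p.2 i) ^ 2 / (2 * p.1 i)) :
        (V → ℝ) × (V → ℝ)))) := hd.mul (hF.comp hψ)
  rw [lintegral_prod_symm' _ hJ]
  have hshift : Measurable fun p : (V → ℝ) × (V → ℝ) =>
      (((fun i => p.2 i - p.1 i / 2), p.1) : (V → ℝ) × (V → ℝ)) :=
    Measurable.prodMk (by fun_prop) measurable_fst
  have hstep : ∀ A : V → ℝ, ∫⁻ δ : V → ℝ, ((fun p : (V → ℝ) × (V → ℝ) =>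
      ENNReal.ofReal (nuDensity W θ η p.1) *
      ∏ i, ENNReal.ofReal (gIG (z i) (θ i) (p.2 i))) * (F ∘ fun p : (V → ℝ) × (V → ℝ) =>
      ((fun i => 2 * p.1 i + p.2 i, fun i => p.2 i + (p.2 i) ^ 2 / (2 * p.1 i)) :
        (V → ℝ) × (V → ℝ)))) (δ, A) = ∫⁻ β : V → ℝ, ((fun p : (V → ℝ) × (V → ℝ) =>
      ENNReal.ofReal (nuDensity W θ η p.1) *
      ∏ i, ENNReal.ofReal (gIG (z i) (θ i) (p.2 i))) * (F ∘ fun p : (V → ℝ) × (V → ℝ) =>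
      ((fun i => 2 * p.1 i + p.2 i, fun i => p.2 i + (p.2 i) ^ 2 / (2 * p.1 i)) :
        (V → ℝ) × (V → ℝ)))) ((fun i => β i - A i / 2), A) := fun A =>
    (lintegral_sub_right_eq_self (μ := (volume : Measure (V → ℝ))) _ (fun i => A i / 2)).symm
  simp only [hstep]
  rw [lintegral_lintegral_swap]
  swap
  · exact (hJ.comp hshift).aemeasurable
  refine lintegral_congr fun β => ?_
  have hk := key_inner W hWsymm hWpos θ η hθ z hz β F
  rw [← lintegral_const_mul' _ _ ENNReal.ofReal_ne_top]
  refine hk.trans (lintegral_congr fun a => ?_)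
  simp only [Pi.mul_apply, Function.comp]
end

section
/- Let θ > 0, T^∞ > 0, and let b : [0,∞) → ℝ be continuous with b(0) = 0. Suppose ρ, T : [0,∞) → ℝ are continuous functions such that for all u ≥ 0: T(u) = ∫₀^u e^{2ρ(v)} dv, T(u) < T^∞, and ρ(u) = log θ + b(u) + u/2 + log((T^∞ − T(u))/T^∞). Define T*(u) = ∫₀^u e^{2b(v)+v} dv. Then for all u ≥ 0, θ² T*(u) = T^∞ T(u)/(T^∞ − T(u)); equivalently, for all u > 0, 1/T(u) = 1/T^∞ + 1/(θ² T*(u)). -/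
open intervalIntegral

/-- The deterministic identity relating the Lamperti time change `T` of the
opposite-drift representation `ρ(u) = log θ + b(u) + u/2 + log((T^∞ − T(u))/T^∞)`
and the exponential functional `T*(u) = ∫₀ᵘ exp(2 b(v) + v) dv`:
`θ² T*(u) = T^∞ T(u)/(T^∞ − T(u))`, i.e. `1/T(u) = 1/T^∞ + 1/(θ² T*(u))`. -/
theorem lamperti_time_change_identity
    (θ Tinf : ℝ) (hθ : 0 < θ) (hTinf : 0 < Tinf)
    (b ρ T : ℝ → ℝ) (hb : Continuous b) (hb0 : b 0 = 0)
    (hρ : Continuous ρ) (hT : Continuous T)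
    (hTdef : ∀ u, 0 ≤ u → T u = ∫ v in (0 : ℝ)..u, Real.exp (2 * ρ v))
    (hTlt : ∀ u, 0 ≤ u → T u < Tinf)
    (hρdef : ∀ u, 0 ≤ u →
      ρ u = Real.log θ + b u + u / 2 + Real.log ((Tinf - T u) / Tinf)) :
    (∀ u, 0 ≤ u →
      θ ^ 2 * (∫ v in (0 : ℝ)..u, Real.exp (2 * b v + v)) =
        Tinf * T u / (Tinf - T u)) ∧
    (∀ u, 0 < u →
      1 / T u = 1 / Tinf +
        1 / (θ ^ 2 * ∫ v in (0 : ℝ)..u, Real.exp (2 * b v + v))) := by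
  have hexp : ∀ u, 0 ≤ u → Real.exp (2 * ρ u) =
      θ ^ 2 * Real.exp (2 * b u + u) * ((Tinf - T u) / Tinf) ^ 2 := by
    intro u hu
    have hp : 0 < (Tinf - T u) / Tinf := div_pos (sub_pos.2 (hTlt u hu)) hTinf
    rw [hρdef u hu]
    have e : 2 * (Real.log θ + b u + u / 2 + Real.log ((Tinf - T u) / Tinf)) =
        (Real.log θ + Real.log θ) + (2 * b u + u) +
          (Real.log ((Tinf - T u) / Tinf) + Real.log ((Tinf - T u) / Tinf)) := by ring
    rw [e, Real.exp_add, Real.exp_add, Real.exp_add (Real.log θ),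
      Real.exp_add (Real.log ((Tinf - T u) / Tinf)), Real.exp_log hθ, Real.exp_log hp]
    ring
  have hcρ : Continuous fun v => Real.exp (2 * ρ v) := by fun_prop
  have hcb : Continuous fun v => Real.exp (2 * b v + v) := by fun_prop
  have hT0 : T 0 = 0 := by rw [hTdef 0 le_rfl]; simp
  have hderT : ∀ u, 0 < u → HasDerivAt T (Real.exp (2 * ρ u)) u := by
    intro u hu
    have h := hcρ.integral_hasStrictDerivAt 0 u |>.hasDerivAt
    refine h.congr_of_eventuallyEq ?_
    filter_upwards [lt_mem_nhds hu] with v hv using hTdef v hv.le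
  have main : ∀ u, 0 ≤ u →
      θ ^ 2 * (∫ v in (0 : ℝ)..u, Real.exp (2 * b v + v)) =
        Tinf * T u / (Tinf - T u) := by
    intro u hu
    rw [← intervalIntegral.integral_const_mul]
    have key := intervalIntegral.integral_eq_sub_of_hasDerivAt_of_le
      (f := fun u => Tinf * T u / (Tinf - T u))
      (f' := fun v => θ ^ 2 * Real.exp (2 * b v + v)) hu ?_ ?_ ?_
    · rw [key]; simp [hT0]
    · apply ContinuousOn.div (by fun_prop) (by fun_prop)
      intro x hx
      exact (sub_pos.2 (hTlt x hx.1)).ne'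
    · intro x hx
      have hne : Tinf - T x ≠ 0 := (sub_pos.2 (hTlt x hx.1.le)).ne'
      have hd := hderT x hx.1
      refine ((hd.const_mul Tinf).div (hd.const_sub Tinf) hne).congr_deriv ?_
      rw [hexp x hx.1.le]
      field_simp
      ring
    · exact (continuous_const.mul hcb).intervalIntegrable _ _
  refine ⟨main, fun u hu => ?_⟩
  rw [main u hu.le]
  have hTpos : 0 < T u := by
    rw [hTdef u hu.le]
    exact intervalIntegral.intervalIntegral_pos_of_pos (hcρ.intervalIntegrable _ _)
      (fun x => Real.exp_pos _) hu
  have hne : Tinf - T u ≠ 0 := (sub_pos.2 (hTlt u hu.le)).ne'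
  field_simp
  ring
end

section
/- Let θ > 0, T^∞ > 0, and let b : [0,∞) → ℝ be continuous with b(0) = 0. Suppose ρ, T : [0,∞) → ℝ are continuous functions such that for all u ≥ 0: T(u) = ∫₀^u e^{2ρ(v)} dv, T(u) < T^∞, and ρ(u) = log θ + b(u) + u/2 + log((T^∞ − T(u))/T^∞). Define e*(u) = e^{b(u)+u/2}, T*(u) = ∫₀^u e*(v)² dv, Z*(u) = T*(u)/e*(u) and Z(u) = T(u) e^{−ρ(u)}. Then for all u ≥ 0: (a) Z(u) = θ Z*(u); (b) θ² Z*(u)/e*(u) + T^∞/e*(u)² = θ² (T^∞ − T(u)) e^{−2ρ(u)}; and (c) 1/e*(u) = θ e^{−ρ(u)} − θ Z(u)/T^∞. -/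
open intervalIntegral

/-- Deterministic identities between the Lamperti time change `T` of the opposite-drift
representation `ρ(u) = log θ + b(u) + u/2 + log((T^∞ − T(u))/T^∞)` and the exponential
functionals `e*(u) = exp(b(u) + u/2)`, `T*(u) = ∫₀ᵘ e*(v)² dv`, `Z*(u) = T*(u)/e*(u)`,
`Z(u) = T(u) e^{−ρ(u)}`:
(a) `Z(u) = θ Z*(u)`;
(b) `θ² Z*(u)/e*(u) + T^∞/e*(u)² = θ² (T^∞ − T(u)) e^{−2ρ(u)}`;
(c) `1/e*(u) = θ e^{−ρ(u)} − θ Z(u)/T^∞`. -/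
theorem lamperti_exponential_functional_identities
    (θ Tinf : ℝ) (hθ : 0 < θ) (hTinf : 0 < Tinf)
    (b ρ T : ℝ → ℝ) (hb : Continuous b) (hb0 : b 0 = 0)
    (hρ : Continuous ρ) (hT : Continuous T)
    (hTdef : ∀ u, 0 ≤ u → T u = ∫ v in (0 : ℝ)..u, Real.exp (2 * ρ v))
    (hTlt : ∀ u, 0 ≤ u → T u < Tinf)
    (hρdef : ∀ u, 0 ≤ u →
      ρ u = Real.log θ + b u + u / 2 + Real.log ((Tinf - T u) / Tinf)) :
    ∀ u, 0 ≤ u →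
      (T u * Real.exp (-ρ u) =
        θ * ((∫ v in (0 : ℝ)..u, Real.exp (b v + v / 2) ^ 2) /
          Real.exp (b u + u / 2))) ∧
      (θ ^ 2 * ((∫ v in (0 : ℝ)..u, Real.exp (b v + v / 2) ^ 2) /
            Real.exp (b u + u / 2)) / Real.exp (b u + u / 2)
          + Tinf / Real.exp (b u + u / 2) ^ 2 =
        θ ^ 2 * (Tinf - T u) * Real.exp (-(2 * ρ u))) ∧
      (1 / Real.exp (b u + u / 2) =
        θ * Real.exp (-ρ u) - θ * (T u * Real.exp (-ρ u)) / Tinf) := by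
  intro u hu
  have hexp : ∀ v, 0 ≤ v →
      Real.exp (ρ v) = θ * Real.exp (b v + v / 2) * ((Tinf - T v) / Tinf) := by
    intro v hv
    have h1 : 0 < (Tinf - T v) / Tinf := div_pos (sub_pos.2 (hTlt v hv)) hTinf
    rw [hρdef v hv, Real.exp_add, Real.exp_log h1, add_assoc, Real.exp_add, Real.exp_log hθ]
  have hcont2 : Continuous (fun v => Real.exp (2 * ρ v)) := by fun_prop
  have hder : ∀ x, 0 < x → HasDerivAt T (Real.exp (2 * ρ x)) x := by
    intro x hx
    have h1 : HasDerivAt (fun w => ∫ v in (0 : ℝ)..w, Real.exp (2 * ρ v))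
        (Real.exp (2 * ρ x)) x := hcont2.integral_hasStrictDerivAt 0 x |>.hasDerivAt
    refine h1.congr_of_eventuallyEq ?_
    filter_upwards [lt_mem_nhds hx] with w hw
    exact hTdef w hw.le
  have hT0 : T 0 = 0 := by simpa using hTdef 0 le_rfl
  have hint : (∫ v in (0 : ℝ)..u, Real.exp (b v + v / 2) ^ 2) =
      (Tinf ^ 2 / θ ^ 2) * (Tinf - T u)⁻¹ - (Tinf ^ 2 / θ ^ 2) * (Tinf - T 0)⁻¹ := by
    refine integral_eq_sub_of_hasDerivAt_of_le
      (f := fun w => (Tinf ^ 2 / θ ^ 2) * (Tinf - T w)⁻¹) hu ?_ ?_ ?_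
    · refine ContinuousOn.mul continuousOn_const (ContinuousOn.inv₀ (by fun_prop) ?_)
      intro x hx
      exact (sub_pos.2 (hTlt x hx.1)).ne'
    · intro x hx
      have hne : Tinf - T x ≠ 0 := (sub_pos.2 (hTlt x hx.1.le)).ne'
      have h := (((hder x hx.1).const_sub Tinf).fun_inv hne).const_mul (Tinf ^ 2 / θ ^ 2)
      refine h.congr_deriv ?_
      have h2 : Real.exp (2 * ρ x) = Real.exp (ρ x) ^ 2 := by
        rw [← Real.exp_nat_mul]; norm_num
      rw [h2, hexp x hx.1.le]
      field_simp
    · exact Continuous.intervalIntegrable (by fun_prop) _ _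
  have h2 : Real.exp (-(2 * ρ u)) = (Real.exp (ρ u) ^ 2)⁻¹ := by
    rw [Real.exp_neg, ← Real.exp_nat_mul]; norm_num
  have hne : Tinf - T u ≠ 0 := (sub_pos.2 (hTlt u hu)).ne'
  have hE : Real.exp (b u + u / 2) ≠ 0 := (Real.exp_pos _).ne'
  rw [hint, h2, Real.exp_neg, hexp u hu, hT0]
  generalize Real.exp (b u + u / 2) = E at *
  simp only [sub_zero]
  refine ⟨?_, ?_, ?_⟩
  · field_simp
    ring
  · field_simp
    ring
  · field_simp
end
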